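/- arXiv:1202.6129 — 5 statements merged into one kernel-verified Lean document; each statement's English description precedes it below -/
import Mathlib

section
/- Let G be an acyclically edge k-critical finite simple graph, let uv be an edge of G, and let φ be an acyclic edge k-coloring of G − uv. If the set of colors appearing on edges incident to u is disjoint from the set of colors appearing on edges incident to v, then d(u) + d(v) ≥ k + 2. -/
open SimpleGraph

/-- A proper edge coloring of `G`: distinct edges sharing a vertex get distinct colors. -/
def IsProperEdgeColoring {V : Type*} {α : Type*} (G : SimpleGraph V) (c : Sym2 V → α) : Prop :=
  ∀ e₁ ∈ G.edgeSet, ∀ e₂ ∈ G.edgeSet, e₁ ≠ e₂ → (∃ v, v ∈ e₁ ∧ v ∈ e₂) → c e₁ ≠ c e₂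

/-- An acyclic edge coloring: proper, and no cycle of `G` uses at most two colors. -/
def IsAcyclicEdgeColoring {V : Type*} {α : Type*} (G : SimpleGraph V) (c : Sym2 V → α) : Prop :=
  IsProperEdgeColoring G c ∧
    ∀ (v : V) (w : G.Walk v v), w.IsCycle →
      ¬ ∃ a b : α, ∀ e ∈ w.edges, c e = a ∨ c e = b

/-- `G` has an acyclic edge coloring with `k` colors. -/
def AcyclicEdgeColorable {V : Type*} (G : SimpleGraph V) (k : ℕ) : Prop :=
  ∃ c : Sym2 V → Fin k, IsAcyclicEdgeColoring G c

/-- The acyclic chromatic index: least `k` such that `G` is acyclically edge `k`-colorable. -/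
noncomputable def acyclicChromaticIndex {V : Type*} (G : SimpleGraph V) : ℕ :=
  sInf {k | AcyclicEdgeColorable G k}

/-- `G` is acyclically edge `k`-critical: `G` is not acyclically edge `k`-colorable, but every
proper subgraph of `G` is. -/
def IsAcyclicallyEdgeCritical {V : Type*} (G : SimpleGraph V) (k : ℕ) : Prop :=
  ¬ AcyclicEdgeColorable G k ∧ ∀ H : SimpleGraph V, H < G → AcyclicEdgeColorable H k

/-- `F_v(c)`: the set of colors appearing on edges of `G` incident to `v`. -/
def colorsAt {V : Type*} {α : Type*} (G : SimpleGraph V) (c : Sym2 V → α) (v : V) : Set α :=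
  {a | ∃ u, G.Adj v u ∧ c s(v, u) = a}

/-- Every edge of a cycle is followed, at each of its ends, by another edge of the cycle. -/
lemma SimpleGraph.Walk.IsCycle.exists_ne_mem_edges {V : Type*} {G : SimpleGraph V} {x u v : V}
    {w : G.Walk x x} (hw : w.IsCycle) (h : s(u, v) ∈ w.edges) :
    ∃ y, y ≠ v ∧ s(u, y) ∈ w.edges := by
  have hcard := hw.ncard_neighborSet_toSubgraph_eq_two (w.fst_mem_support_of_mem_edges h)
  obtain ⟨y, hy, hne⟩ := Set.exists_ne_of_one_lt_ncard (hcard ▸ one_lt_two) v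
  exact ⟨y, hne, w.adj_toSubgraph_iff_mem_edges.1 hy⟩

/-- A coloring of `G - uv` with `F_u` and `F_v` disjoint extends to `G` by any color `a`
outside `F_u ∪ F_v`. -/
lemma IsAcyclicEdgeColoring.update_of_disjoint {V α : Type*} [DecidableEq (Sym2 V)]
    {G : SimpleGraph V} {u v : V} {c : Sym2 V → α}
    (hc : IsAcyclicEdgeColoring (G.deleteEdges {s(u, v)}) c)
    (hdisj : Disjoint (colorsAt (G.deleteEdges {s(u, v)}) c u)
      (colorsAt (G.deleteEdges {s(u, v)}) c v)) {a : α}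
    (hau : a ∉ colorsAt (G.deleteEdges {s(u, v)}) c u)
    (hav : a ∉ colorsAt (G.deleteEdges {s(u, v)}) c v) :
    IsAcyclicEdgeColoring G (Function.update c s(u, v) a) := by
  have hnew : ∀ e ∈ G.edgeSet, e ≠ s(u, v) → (∃ x, x ∈ s(u, v) ∧ x ∈ e) → c e ≠ a := by
    rintro e he hne ⟨x, hx, hxe⟩ hea
    obtain ⟨y, rfl⟩ := Sym2.mem_iff_exists.1 hxe
    have hadj : (G.deleteEdges {s(u, v)}).Adj x y := deleteEdges_adj.2 ⟨he, hne⟩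
    rcases Sym2.mem_iff.1 hx with rfl | rfl
    · exact hau ⟨y, hadj, hea⟩
    · exact hav ⟨y, hadj, hea⟩
  refine ⟨?_, ?_⟩
  · rintro e₁ h₁ e₂ h₂ hne ⟨x, hx₁, hx₂⟩
    by_cases h₁' : e₁ = s(u, v)
    · subst h₁'
      rw [Function.update_self, Function.update_of_ne hne.symm]
      exact (hnew e₂ h₂ hne.symm ⟨x, hx₁, hx₂⟩).symm
    by_cases h₂' : e₂ = s(u, v)
    · subst h₂'
      rw [Function.update_self, Function.update_of_ne hne]
      exact hnew e₁ h₁ hne ⟨x, hx₂, hx₁⟩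
    rw [Function.update_of_ne h₁', Function.update_of_ne h₂']
    refine hc.1 e₁ ?_ e₂ ?_ hne ⟨x, hx₁, hx₂⟩ <;> simp [edgeSet_deleteEdges, *]
  · rintro x w hw ⟨p, q, hpq⟩
    by_cases huv : s(u, v) ∈ w.edges
    · obtain ⟨y, hyv, hy⟩ := hw.exists_ne_mem_edges huv
      obtain ⟨z, hzu, hz⟩ := hw.exists_ne_mem_edges (Sym2.eq_swap ▸ huv)
      have hy' : s(u, y) ≠ s(u, v) := fun h ↦ hyv (Sym2.congr_right.1 h)
      have hz' : s(v, z) ≠ s(u, v) := fun h ↦ hzu (Sym2.congr_right.1 (h.trans Sym2.eq_swap))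
      have hyG := w.edges_subset_edgeSet hy
      have hzG := w.edges_subset_edgeSet hz
      have hya := hnew _ hyG hy' ⟨u, by simp, by simp⟩
      have hza := hnew _ hzG hz' ⟨v, by simp, by simp⟩
      have h₁ := hpq _ huv
      have h₂ := hpq _ hy
      have h₃ := hpq _ hz
      rw [Function.update_self] at h₁
      rw [Function.update_of_ne hy'] at h₂
      rw [Function.update_of_ne hz'] at h₃
      exact Set.disjoint_left.1 hdisj ⟨y, deleteEdges_adj.2 ⟨hyG, hy'⟩, rfl⟩
        ⟨z, deleteEdges_adj.2 ⟨hzG, hz'⟩, by grind⟩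
    · have hne : ∀ e ∈ w.edges, e ≠ s(u, v) := fun e he h ↦ huv (h ▸ he)
      have hsub : ∀ e ∈ w.edges, e ∈ (G.deleteEdges {s(u, v)}).edgeSet := fun e he ↦ by
        simpa [edgeSet_deleteEdges, hne e he] using w.edges_subset_edgeSet he
      refine hc.2 x (w.transfer _ hsub) (hw.transfer hsub) ⟨p, q, fun e he ↦ ?_⟩
      rw [Walk.edges_transfer] at he
      simpa [Function.update_of_ne (hne e he)] using hpq e he

/-- After deleting the edge `uv`, fewer than `d(u)` colors appear at `u`. -/
lemma ncard_colorsAt_deleteEdges_lt {V α : Type*} [Fintype V] {G : SimpleGraph V}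
    [DecidableRel G.Adj] {u v : V} (huv : G.Adj u v) (c : Sym2 V → α) :
    (colorsAt (G.deleteEdges {s(u, v)}) c u).ncard < G.degree u := by
  classical
  have hsub : colorsAt (G.deleteEdges {s(u, v)}) c u ⊆
      (((G.neighborFinset u).erase v).image fun x ↦ c s(u, x) : Finset α) := by
    rintro a ⟨x, hx, rfl⟩
    rw [deleteEdges_adj] at hx
    have hxv : x ≠ v := by
      rintro rfl
      exact hx.2 rfl
    exact Finset.mem_coe.2 (Finset.mem_image_of_mem _
      (Finset.mem_erase.2 ⟨hxv, (G.mem_neighborFinset u x).2 hx.1⟩))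
  have hmem : v ∈ G.neighborFinset u := by simpa using huv
  calc
    _ ≤ (((G.neighborFinset u).erase v).image fun x ↦ c s(u, x)).card := by
      simpa only [Set.ncard_coe_finset] using Set.ncard_le_ncard hsub (Finset.finite_toSet _)
    _ ≤ ((G.neighborFinset u).erase v).card := Finset.card_image_le
    _ < G.degree u := Finset.card_erase_lt_of_mem hmem

theorem stmt3 {V : Type*} [Fintype V] (G : SimpleGraph V) [DecidableRel G.Adj]
    (k : ℕ) (hG : IsAcyclicallyEdgeCritical G k) (u v : V) (huv : G.Adj u v)
    (c : Sym2 V → Fin k)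
    (hc : IsAcyclicEdgeColoring (G.deleteEdges {s(u, v)}) c)
    (hdisj : Disjoint (colorsAt (G.deleteEdges {s(u, v)}) c u)
      (colorsAt (G.deleteEdges {s(u, v)}) c v)) :
    k + 2 ≤ G.degree u + G.degree v := by
  classical
  by_contra! hlt
  have hu := ncard_colorsAt_deleteEdges_lt huv c
  have hv := ncard_colorsAt_deleteEdges_lt huv.symm c
  rw [Sym2.eq_swap] at hv
  obtain ⟨a, ha⟩ : ∃ a, a ∉ colorsAt (G.deleteEdges {s(u, v)}) c u ∪
      colorsAt (G.deleteEdges {s(u, v)}) c v := by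
    by_contra! hall
    have hunion := Set.ncard_union_le (colorsAt (G.deleteEdges {s(u, v)}) c u)
      (colorsAt (G.deleteEdges {s(u, v)}) c v)
    rw [Set.eq_univ_of_forall hall, Set.ncard_univ, Nat.card_fin] at hunion
    omega
  rw [Set.mem_union, not_or] at ha
  exact hG.1 ⟨_, hc.update_of_disjoint hdisj ha.1 ha.2⟩
end

section
/- Let G be an acyclically edge k-critical finite simple graph, let uv be an edge of G, and let φ be an acyclic edge k-coloring of G − uv. Suppose the sets of colors at u and at v share exactly t common colors, realized by edges uu_1,…,uu_t at u and vv_1,…,vv_t at v with φ(uu_i) = φ(vv_i) for i = 1,…,t. Then d(v_1) + ⋯ + d(v_t) + d(u) + d(v) ≥ k + t + 2, and likewise d(u_1) + ⋯ + d(u_t) + d(u) + d(v) ≥ k + t + 2. -/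
open SimpleGraph

/-- An edge of a cycle is continued, at either of its ends, by another edge of the cycle. -/
theorem SimpleGraph.Walk.IsCycle.exists_mem_edges_of_mem_edges {V : Type*} {G : SimpleGraph V}
    {a x y : V} {w : G.Walk a a} (hw : w.IsCycle) (h : s(x, y) ∈ w.edges) :
    ∃ z, z ≠ x ∧ s(y, z) ∈ w.edges := by
  have h2 := hw.ncard_neighborSet_toSubgraph_eq_two (w.snd_mem_support_of_mem_edges h)
  obtain ⟨z, hz, hzx⟩ := Set.exists_ne_of_one_lt_ncard (h2.symm ▸ Nat.one_lt_two) x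
  rw [Subgraph.mem_neighborSet, Walk.adj_toSubgraph_iff_mem_edges] at hz
  exact ⟨z, hzx, hz⟩

theorem IsProperEdgeColoring.eq_of_color_eq {V α : Type*} {G : SimpleGraph V} {c : Sym2 V → α}
    (hc : IsProperEdgeColoring G c) {x y z : V} (hy : G.Adj x y) (hz : G.Adj x z)
    (h : c s(x, y) = c s(x, z)) : y = z := by
  by_contra hne
  exact hc s(x, y) hy s(x, z) hz (mt Sym2.congr_right.mp hne) ⟨x, by simp⟩ h

/-- A proper coloring of `G - uv` extends to `G` by a color that is missing at `u` and at `v`. -/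
theorem IsProperEdgeColoring.update {V α : Type*} [DecidableEq V] {G : SimpleGraph V}
    {c : Sym2 V → α} {u v : V} (hc : IsProperEdgeColoring (G.deleteEdges {s(u, v)}) c) {j : α}
    (hju : j ∉ colorsAt (G.deleteEdges {s(u, v)}) c u)
    (hjv : j ∉ colorsAt (G.deleteEdges {s(u, v)}) c v) :
    IsProperEdgeColoring G (Function.update c s(u, v) j) := by
  have key : ∀ e ∈ G.edgeSet, e ≠ s(u, v) → (∃ x, x ∈ s(u, v) ∧ x ∈ e) → c e ≠ j := by
    rintro e he hne ⟨x, hx, hxe⟩ rfl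
    obtain ⟨y, rfl⟩ := Sym2.mem_iff_exists.mp hxe
    have hadj : (G.deleteEdges {s(u, v)}).Adj x y := by
      rw [deleteEdges_adj]
      exact ⟨he, hne⟩
    rcases Sym2.mem_iff.mp hx with rfl | rfl
    · exact hju ⟨y, hadj, rfl⟩
    · exact hjv ⟨y, hadj, rfl⟩
  intro e₁ h₁ e₂ h₂ hne ⟨x, hx₁, hx₂⟩
  by_cases e1 : e₁ = s(u, v)
  · subst e1
    rw [Function.update_self, Function.update_of_ne hne.symm]
    exact (key e₂ h₂ hne.symm ⟨x, hx₁, hx₂⟩).symm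
  by_cases e2 : e₂ = s(u, v)
  · subst e2
    rw [Function.update_self, Function.update_of_ne hne]
    exact key e₁ h₁ hne ⟨x, hx₂, hx₁⟩
  rw [Function.update_of_ne e1, Function.update_of_ne e2]
  exact hc e₁ (by simp [edgeSet_deleteEdges, h₁, e1]) e₂ (by simp [edgeSet_deleteEdges, h₂, e2])
    hne ⟨x, hx₁, hx₂⟩

/-- If `uv` cannot be given the color `j` missing at both `u` and `v`, then a neighbor of `v` along
an edge of some color common to `u` and `v` sees `j`. -/
theorem IsAcyclicEdgeColoring.exists_mem_colorsAt {V α : Type*} [DecidableEq V]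
    {G : SimpleGraph V} {c : Sym2 V → α} {u v : V}
    (hc : IsAcyclicEdgeColoring (G.deleteEdges {s(u, v)}) c) {j : α}
    (hju : j ∉ colorsAt (G.deleteEdges {s(u, v)}) c u)
    (hjv : j ∉ colorsAt (G.deleteEdges {s(u, v)}) c v)
    (hG : ¬ IsAcyclicEdgeColoring G (Function.update c s(u, v) j)) :
    ∃ x, (G.deleteEdges {s(u, v)}).Adj v x ∧
      c s(v, x) ∈ colorsAt (G.deleteEdges {s(u, v)}) c u ∧
      j ∈ colorsAt (G.deleteEdges {s(u, v)}) c x := by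
  have hp := hc.1.update hju hjv
  have hex : ∃ (a : V) (w : G.Walk a a), w.IsCycle ∧
      ∃ p q : α, ∀ e ∈ w.edges,
        Function.update c s(u, v) j e = p ∨ Function.update c s(u, v) j e = q := by
    by_contra hcon
    exact hG ⟨hp, fun a w hw hpq => hcon ⟨a, w, hw, hpq⟩⟩
  obtain ⟨a, w, hw, p, q, hpq⟩ := hex
  have hadj : ∀ {x y : V}, s(x, y) ∈ w.edges → G.Adj x y := w.adj_of_mem_edges
  have huvw : s(u, v) ∈ w.edges := by
    by_contra hnot
    have hne : ∀ e ∈ w.edges, e ≠ s(u, v) := fun e he h => hnot (h ▸ he)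
    have hmem : ∀ e ∈ w.edges, e ∈ (G.deleteEdges {s(u, v)}).edgeSet := fun e he => by
      simp [edgeSet_deleteEdges, w.edges_subset_edgeSet he, hne e he]
    refine hc.2 a (w.transfer _ hmem) (hw.transfer hmem) ⟨p, q, fun e he => ?_⟩
    rw [Walk.edges_transfer] at he
    simpa [Function.update_of_ne (hne e he)] using hpq e he
  have third : ∀ {x y z : V}, s(x, y) ∈ w.edges → s(y, z) ∈ w.edges → z ≠ x →
      Function.update c s(u, v) j s(x, y) ≠ Function.update c s(u, v) j s(y, z) := by
    intro x y z hxy hyz hzx h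
    rw [Sym2.eq_swap (a := x)] at h
    exact hzx (hp.eq_of_color_eq (hadj hxy).symm (hadj hyz) h).symm
  have hdel : ∀ {x y : V}, s(x, y) ∈ w.edges → s(x, y) ≠ s(u, v) →
      (G.deleteEdges {s(u, v)}).Adj x y := fun h hne => by
    rw [deleteEdges_adj]
    exact ⟨hadj h, hne⟩
  obtain ⟨x, hxu, hvx⟩ := hw.exists_mem_edges_of_mem_edges huvw
  obtain ⟨y, hyv, huy⟩ := hw.exists_mem_edges_of_mem_edges (Sym2.eq_swap ▸ huvw)
  obtain ⟨z, hzv, hxz⟩ := hw.exists_mem_edges_of_mem_edges hvx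
  have huv := (hadj huvw).ne
  have hvx' := (hadj hvx).ne
  have nvx : s(v, x) ≠ s(u, v) := by grind
  have nuy : s(u, y) ≠ s(u, v) := by grind
  have nxz : s(x, z) ≠ s(u, v) := by grind
  have h₁ := third huvw hvx hxu
  have h₂ := third (Sym2.eq_swap ▸ huvw : s(v, u) ∈ w.edges) huy hyv
  have h₃ := third hvx hxz hzv
  have g₀ := hpq _ huvw
  have g₁ := hpq _ hvx
  have g₂ := hpq _ huy
  have g₃ := hpq _ hxz
  rw [Sym2.eq_swap (a := v)] at h₂
  simp only [Function.update_self, Function.update_of_ne nvx, Function.update_of_ne nuy,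
    Function.update_of_ne nxz] at h₁ h₂ h₃ g₀ g₁ g₂ g₃
  exact ⟨x, hdel hvx nvx, ⟨y, hdel huy nuy, by grind⟩, ⟨z, hdel hxz nxz, by grind⟩⟩

theorem ncard_colorsAt_le_degree {V α : Type*} [Fintype V] (G : SimpleGraph V)
    [DecidableRel G.Adj] (c : Sym2 V → α) (v : V) : (colorsAt G c v).ncard ≤ G.degree v := by
  classical
  have h : colorsAt G c v = ((G.neighborFinset v).image fun x => c s(v, x) : Finset α) := by
    ext a
    simp [colorsAt]
  rw [h, Set.ncard_coe_finset]
  exact Finset.card_image_le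

theorem degree_deleteEdges_singleton_lt {V : Type*} [Fintype V] {G : SimpleGraph V} {e : Sym2 V}
    {x : V} [DecidableRel G.Adj] [DecidableRel (G.deleteEdges {e}).Adj] (he : e ∈ G.edgeSet)
    (hx : x ∈ e) : (G.deleteEdges {e}).degree x < G.degree x := by
  obtain ⟨y, rfl⟩ := Sym2.mem_iff_exists.mp hx
  refine Finset.card_lt_card ((Finset.ssubset_iff_of_subset ?_).mpr ⟨y, ?_, ?_⟩)
  · intro z
    simp +contextual [deleteEdges_adj]
  · simpa using he
  · simp [deleteEdges_adj]

/-- The degree bound at one end `v` of the edge `uv`. -/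
theorem IsAcyclicEdgeColoring.add_le_sum_degree {V : Type*} [Fintype V] {G : SimpleGraph V}
    [DecidableRel G.Adj] {k t : ℕ} (hG : ¬ AcyclicEdgeColorable G k) {u v : V} (huv : G.Adj u v)
    {c : Sym2 V → Fin k} (hc : IsAcyclicEdgeColoring (G.deleteEdges {s(u, v)}) c) {vi : Fin t → V}
    (hvi : ∀ i, (G.deleteEdges {s(u, v)}).Adj v (vi i))
    (hcolinj : Function.Injective fun i => c s(v, vi i))
    (hint : colorsAt (G.deleteEdges {s(u, v)}) c u ∩ colorsAt (G.deleteEdges {s(u, v)}) c v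
      = Set.range fun i => c s(v, vi i)) :
    k + t + 2 ≤ (∑ i, G.degree (vi i)) + G.degree u + G.degree v := by
  classical
  set H := G.deleteEdges {s(u, v)}
  have hcover : (Set.univ : Set (Fin k)) ⊆
      (colorsAt H c u ∪ colorsAt H c v) ∪ ⋃ i, colorsAt H c (vi i) := by
    intro j _
    by_contra hj
    simp only [Set.mem_union, Set.mem_iUnion, not_or, not_exists] at hj
    obtain ⟨⟨hju, hjv⟩, hjx⟩ := hj
    obtain ⟨x, hvx, hx, hjx'⟩ := hc.exists_mem_colorsAt hju hjv fun h => hG ⟨_, h⟩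
    have hmem : c s(v, x) ∈ colorsAt H c u ∩ colorsAt H c v := ⟨hx, x, hvx, rfl⟩
    rw [hint] at hmem
    obtain ⟨i, hi⟩ := hmem
    exact hjx i (hc.1.eq_of_color_eq (hvi i) hvx hi ▸ hjx')
  have hk := (Set.ncard_le_ncard hcover).trans (Set.ncard_union_le _ _)
  rw [Set.ncard_univ, Nat.card_fin] at hk
  have hinter := Set.ncard_union_add_ncard_inter (colorsAt H c u) (colorsAt H c v)
  have ht : (Set.range fun i => c s(v, vi i)).ncard = t := by
    rw [← Set.image_univ, Set.ncard_image_of_injective _ hcolinj, Set.ncard_univ, Nat.card_fin]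
  rw [hint, ht] at hinter
  have hu : (colorsAt H c u).ncard < G.degree u :=
    (ncard_colorsAt_le_degree H c u).trans_lt (degree_deleteEdges_singleton_lt huv (by simp))
  have hv : (colorsAt H c v).ncard < G.degree v :=
    (ncard_colorsAt_le_degree H c v).trans_lt (degree_deleteEdges_singleton_lt huv (by simp))
  have hsum : (⋃ i, colorsAt H c (vi i)).ncard ≤ ∑ i, G.degree (vi i) := by
    refine (Set.ncard_iUnion_le_of_fintype _).trans (Finset.sum_le_sum fun i _ => ?_)
    exact (ncard_colorsAt_le_degree H c _).trans (degree_le_of_le (deleteEdges_le _))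
  omega

theorem stmt4 {V : Type*} [Fintype V] (G : SimpleGraph V) [DecidableRel G.Adj]
    (k t : ℕ) (hG : IsAcyclicallyEdgeCritical G k) (u v : V) (huv : G.Adj u v)
    (c : Sym2 V → Fin k)
    (hc : IsAcyclicEdgeColoring (G.deleteEdges {s(u, v)}) c)
    (ui vi : Fin t → V)
    (hui : ∀ i, (G.deleteEdges {s(u, v)}).Adj u (ui i))
    (hvi : ∀ i, (G.deleteEdges {s(u, v)}).Adj v (vi i))
    (huinj : Function.Injective ui) (hvinj : Function.Injective vi)
    (heq : ∀ i, c s(u, ui i) = c s(v, vi i))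
    (hcolinj : Function.Injective fun i => c s(u, ui i))
    (hint : colorsAt (G.deleteEdges {s(u, v)}) c u ∩ colorsAt (G.deleteEdges {s(u, v)}) c v
      = Set.range fun i => c s(u, ui i)) :
    k + t + 2 ≤ (∑ i, G.degree (vi i)) + G.degree u + G.degree v ∧
      k + t + 2 ≤ (∑ i, G.degree (ui i)) + G.degree u + G.degree v := by
  have heq' : (fun i => c s(u, ui i)) = fun i => c s(v, vi i) := funext heq
  refine ⟨IsAcyclicEdgeColoring.add_le_sum_degree hG.1 huv hc hvi (heq' ▸ hcolinj)
    (hint.trans (congrArg Set.range heq')), ?_⟩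
  rw [Sym2.eq_swap] at hc hui hint
  rw [Set.inter_comm] at hint
  have := IsAcyclicEdgeColoring.add_le_sum_degree hG.1 huv.symm hc hui hcolinj hint
  omega
end

section
/- Let G be an acyclically edge k-critical finite simple graph with k ≤ 2Δ(G) − 2, and let v be a vertex of G adjacent to a vertex of degree 2. Then v is adjacent to at least k − Δ(G) + 1 vertices of degree at least k − Δ(G) + 2. -/
open SimpleGraph

namespace SimpleGraph

variable {V α : Type*} {G : SimpleGraph V}

theorem isProperEdgeColoring_iff {c : Sym2 V → α} :
    IsProperEdgeColoring G c ↔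
      ∀ x y z, G.Adj x y → G.Adj x z → y ≠ z → c s(x, y) ≠ c s(x, z) := by
  constructor
  · intro h x y z hy hz hne
    refine h _ hy _ hz ?_ ⟨x, by simp, by simp⟩
    exact fun h => hne (Sym2.congr_right.1 h)
  · rintro h e₁ h₁ e₂ h₂ hne ⟨x, hx₁, hx₂⟩
    obtain ⟨y, rfl⟩ := hx₁
    obtain ⟨z, rfl⟩ := hx₂
    exact h x y z h₁ h₂ fun hyz => hne (by rw [hyz])

/-- Every vertex of a cycle has, besides a given vertex, another neighbor along the cycle. -/
theorem Walk.IsCycle.exists_mem_edges_ne {v : V} {p : G.Walk v v} (hp : p.IsCycle) {x : V}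
    (hx : x ∈ p.support) (y : V) : ∃ z, z ≠ y ∧ s(x, z) ∈ p.edges := by
  have h := hp.ncard_neighborSet_toSubgraph_eq_two hx
  obtain ⟨z, hz, hzy⟩ := Set.exists_ne_of_one_lt_ncard (by rw [h]; norm_num) y
  exact ⟨z, hzy, Walk.adj_toSubgraph_iff_mem_edges.1 hz⟩

variable [DecidableEq V]

/-- If an acyclic edge coloring of `G` with a vertex `u` of degree two isolated does not extend to
`G` by coloring `uv` with `a` and `uw` with `b`, then a path `v, z, x` colored `b, a` exists. -/
theorem exists_alternating_path_of_not_extend {u v w : V} (hvw : v ≠ w)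
    (huv : G.Adj u v) (huw : G.Adj u w) (hu : ∀ y, G.Adj u y → y = v ∨ y = w) {c : Sym2 V → α}
    (hc : IsAcyclicEdgeColoring (G.deleteIncidenceSet u) c)
    (hG : ∀ c : Sym2 V → α, ¬ IsAcyclicEdgeColoring G c) {a b : α} (hab : a ≠ b)
    (ha : ∀ z, (G.deleteIncidenceSet u).Adj v z → c s(v, z) ≠ a)
    (hb : ∀ z, (G.deleteIncidenceSet u).Adj w z → c s(w, z) ≠ b) :
    ∃ z x, (G.deleteIncidenceSet u).Adj v z ∧ c s(v, z) = b ∧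
      (G.deleteIncidenceSet u).Adj z x ∧ x ≠ v ∧ c s(z, x) = a := by
  obtain ⟨hprop, hcyc⟩ := hc
  rw [isProperEdgeColoring_iff] at hprop
  simp only [deleteIncidenceSet_adj] at hprop ha hb ⊢
  let c' : Sym2 V → α := fun e => if e = s(u, v) then a else if e = s(u, w) then b else c e
  have c'_uv : c' s(u, v) = a := by simp [c']
  have c'_uw : c' s(u, w) = b := by simp [c', hvw.symm, huv.ne]
  have c'_vu : c' s(v, u) = a := by rw [Sym2.eq_swap, c'_uv]
  have c'_wu : c' s(w, u) = b := by rw [Sym2.eq_swap, c'_uw]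
  have c'_of_ne {x y : V} (hx : x ≠ u) (hy : y ≠ u) : c' s(x, y) = c s(x, y) := by
    simp [c', hx, hy]
  have hprop' : ∀ x y z, G.Adj x y → G.Adj x z → y ≠ z → c' s(x, y) ≠ c' s(x, z) := by
    have key (x z : V) (hxu : G.Adj x u) (hxz : G.Adj x z) (hz : z ≠ u) :
        c' s(x, u) ≠ c' s(x, z) := by
      rw [c'_of_ne hxu.ne hz]
      rcases hu x hxu.symm with rfl | rfl
      · rw [c'_vu]; exact (ha z ⟨hxz, hxu.ne, hz⟩).symm
      · rw [c'_wu]; exact (hb z ⟨hxz, hxu.ne, hz⟩).symm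
    intro x y z hy hz hne
    by_cases hx : x = u
    · subst hx
      rcases hu y hy with rfl | rfl <;> rcases hu z hz with rfl | rfl
      · exact absurd rfl hne
      · rwa [c'_uv, c'_uw]
      · rw [c'_uv, c'_uw]; exact hab.symm
      · exact absurd rfl hne
    by_cases hyu : y = u
    · subst hyu; exact key x z hy hz hne.symm
    by_cases hzu : z = u
    · subst hzu; exact (key x y hz hy hne).symm
    rw [c'_of_ne hx hyu, c'_of_ne hx hzu]
    exact hprop x y z ⟨hy, hx, hyu⟩ ⟨hz, hx, hzu⟩ hne
  have hnot := hG c'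
  rw [IsAcyclicEdgeColoring, isProperEdgeColoring_iff] at hnot
  push Not at hnot
  obtain ⟨x₀, p, hp, q, r, hqr⟩ := hnot hprop'
  have hup : u ∈ p.support := by
    by_contra hup
    have hne : ∀ x y, s(x, y) ∈ p.edges → x ≠ u ∧ y ≠ u := fun x y h =>
      ⟨fun hx => hup (hx ▸ p.fst_mem_support_of_mem_edges h),
        fun hy => hup (hy ▸ p.snd_mem_support_of_mem_edges h)⟩
    have hmem : ∀ e ∈ p.edges, e ∈ (G.deleteIncidenceSet u).edgeSet := by
      rintro ⟨x, y⟩ he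
      exact deleteIncidenceSet_adj.2 ⟨p.adj_of_mem_edges he, hne x y he⟩
    refine hcyc x₀ (p.transfer _ hmem) (hp.transfer hmem) ⟨q, r, ?_⟩
    rw [Walk.edges_transfer]
    rintro ⟨x, y⟩ he
    have := hqr _ he
    rwa [← c'_of_ne (hne x y he).1 (hne x y he).2]
  have huvp : s(u, v) ∈ p.edges := by
    obtain ⟨y, hy, hyp⟩ := hp.exists_mem_edges_ne hup w
    rcases hu y (p.adj_of_mem_edges hyp) with rfl | rfl
    · exact hyp
    · exact absurd rfl hy
  have huwp : s(u, w) ∈ p.edges := by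
    obtain ⟨y, hy, hyp⟩ := hp.exists_mem_edges_ne hup v
    rcases hu y (p.adj_of_mem_edges hyp) with rfl | rfl
    · exact absurd rfl hy
    · exact hyp
  have hcol : ∀ e ∈ p.edges, c' e = a ∨ c' e = b := by
    have h₁ := hqr _ huvp
    have h₂ := hqr _ huwp
    rw [c'_uv] at h₁
    rw [c'_uw] at h₂
    intro e he
    have := hqr e he
    grind
  obtain ⟨z, hzu, hvz⟩ := hp.exists_mem_edges_ne (p.snd_mem_support_of_mem_edges huvp) u
  have hvz' := p.adj_of_mem_edges hvz
  have hvzb : c' s(v, z) = b := by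
    refine (hcol _ hvz).resolve_left fun h => ?_
    exact hprop' v z u hvz' huv.symm hzu (h.trans c'_vu.symm)
  obtain ⟨x, hxv, hzx⟩ := hp.exists_mem_edges_ne (p.snd_mem_support_of_mem_edges hvz) v
  have hzx' := p.adj_of_mem_edges hzx
  have hzxa : c' s(z, x) = a := by
    refine (hcol _ hzx).resolve_right fun h => ?_
    refine hprop' z x v hzx' hvz'.symm hxv (h.trans ?_)
    rw [Sym2.eq_swap, hvzb]
  have hxu : x ≠ u := by
    rintro rfl
    rcases hu z hzx'.symm with rfl | rfl
    · exact hvz'.ne rfl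
    · exact hab (hzxa.symm.trans c'_wu)
  rw [c'_of_ne huv.ne' hzu] at hvzb
  rw [c'_of_ne hzu hxu] at hzxa
  exact ⟨z, x, ⟨hvz', huv.ne', hzu⟩, hvzb, ⟨hzx', hzu, hxu⟩, hxv, hzxa⟩

/-- The colors missing at a neighbor `v` of the isolated vertex `u` number at least
`k + 1 - Δ(G)`. -/
theorem le_card_missing_colors [Fintype V] [DecidableRel G.Adj] {k : ℕ} (c : Sym2 V → Fin k)
    {u v : V} (huv : G.Adj v u) (s : Finset (Fin k))
    (hs : ∀ a, a ∉ s → ∃ z, (G.deleteIncidenceSet u).Adj v z ∧ c s(v, z) = a) :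
    k + 1 - G.maxDegree ≤ s.card := by
  have hsub : sᶜ ⊆ ((G.neighborFinset v).erase u).image fun z => c s(v, z) := by
    intro a ha
    obtain ⟨z, hz, rfl⟩ := hs a (Finset.mem_compl.1 ha)
    rw [deleteIncidenceSet_adj] at hz
    refine Finset.mem_image_of_mem _ ?_
    simpa [hz.2.2] using hz.1
  have h₁ := (Finset.card_le_card hsub).trans Finset.card_image_le
  rw [Finset.card_erase_of_mem (by simpa using huv), card_neighborFinset_eq_degree,
    Finset.card_compl, Fintype.card_fin] at h₁
  have h₂ := G.degree_le_maxDegree v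
  have h₃ : 0 < G.degree v := G.degree_pos_iff_exists_adj v |>.2 ⟨u, huv⟩
  omega

end SimpleGraph

theorem stmt6 {V : Type*} [Fintype V] [DecidableEq V] (G : SimpleGraph V) [DecidableRel G.Adj]
    (k : ℕ) (hG : IsAcyclicallyEdgeCritical G k) (hk : k ≤ 2 * G.maxDegree - 2)
    (v u : V) (huv : G.Adj v u) (hu : G.degree u = 2) :
    k - G.maxDegree + 1 ≤
      ((G.neighborFinset v).filter fun w => k - G.maxDegree + 2 ≤ G.degree w).card := by
  classical
  rcases Nat.lt_or_ge G.maxDegree k with hlt | hle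
  swap
  · rw [Nat.sub_eq_zero_of_le hle]
    exact Finset.card_pos.2 ⟨u, by simp [huv, hu]⟩
  obtain ⟨w, hwv, huw, hnbr⟩ : ∃ w, v ≠ w ∧ G.Adj u w ∧ ∀ y, G.Adj u y → y = v ∨ y = w := by
    rw [← card_neighborFinset_eq_degree, Finset.card_eq_two] at hu
    obtain ⟨x, y, hxy, hN⟩ := hu
    have hN' : ∀ z, G.Adj u z ↔ z = x ∨ z = y := fun z => by
      rw [← mem_neighborFinset, hN]; simp
    rcases (hN' v).1 huv.symm with rfl | rfl
    · exact ⟨y, hxy, (hN' y).2 (Or.inr rfl), fun z hz => (hN' z).1 hz⟩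
    · exact ⟨x, hxy.symm, (hN' x).2 (Or.inl rfl), fun z hz => ((hN' z).1 hz).symm⟩
  obtain ⟨c, hc⟩ := hG.2 (G.deleteIncidenceSet u) <| by
    refine lt_of_le_of_ne (G.deleteIncidenceSet_le u) fun h => ?_
    have := deleteIncidenceSet_adj.1 (h ▸ huv)
    exact this.2.2 rfl
  have hprop := isProperEdgeColoring_iff.1 hc.1
  let A : Finset (Fin k) := Finset.univ.filter fun a =>
    ∀ z, (G.deleteIncidenceSet u).Adj v z → c s(v, z) ≠ a
  let B : Finset (Fin k) := Finset.univ.filter fun b =>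
    ∀ z, (G.deleteIncidenceSet u).Adj w z → c s(w, z) ≠ b
  have hA : k + 1 - G.maxDegree ≤ A.card :=
    le_card_missing_colors c huv A fun a ha => by simpa [A] using ha
  have hB : k + 1 - G.maxDegree ≤ B.card :=
    le_card_missing_colors c huw.symm B fun b hb => by simpa [B] using hb
  have hpath : ∀ a ∈ A, ∀ b ∈ B, a ≠ b → ∃ z x, (G.deleteIncidenceSet u).Adj v z ∧
      c s(v, z) = b ∧ (G.deleteIncidenceSet u).Adj z x ∧ x ≠ v ∧ c s(z, x) = a :=
    fun a ha b hb hab => exists_alternating_path_of_not_extend hwv huv.symm huw hnbr hc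
      (fun c hc => hG.1 ⟨c, hc⟩) hab (Finset.mem_filter.1 ha).2 (Finset.mem_filter.1 hb).2
  have hnbr_of_mem : ∀ b ∈ B, ∃ z, c s(v, z) = b ∧
      z ∈ (G.neighborFinset v).filter fun w => k - G.maxDegree + 2 ≤ G.degree w := by
    intro b hb
    obtain ⟨a, ha, hab⟩ := Finset.exists_mem_ne (by omega : 1 < A.card) b
    obtain ⟨z, -, hvz, hzb, -⟩ := hpath a ha b hb hab
    have hbA : b ∉ A := fun h => (Finset.mem_filter.1 h).2 z hvz hzb
    have hvz' := (deleteIncidenceSet_adj.1 hvz).1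
    refine ⟨z, hzb, Finset.mem_filter.2 ⟨by simpa using hvz', ?_⟩⟩
    have hsub : A ⊆ ((G.neighborFinset z).erase v).image fun x => c s(z, x) := by
      intro a ha
      obtain ⟨z', x, hvz₁, hzb₁, hzx, hxv, rfl⟩ := hpath a ha b hb (fun h => hbA (h ▸ ha))
      obtain rfl : z' = z := by
        by_contra hne
        exact hprop v z' z hvz₁ hvz hne (hzb₁.trans hzb.symm)
      refine Finset.mem_image_of_mem _ ?_
      simpa [hxv] using (deleteIncidenceSet_adj.1 hzx).1
    have h := (Finset.card_le_card hsub).trans Finset.card_image_le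
    rw [Finset.card_erase_of_mem (by simpa using hvz'.symm), card_neighborFinset_eq_degree] at h
    omega
  have hsub : B ⊆ ((G.neighborFinset v).filter fun w =>
      k - G.maxDegree + 2 ≤ G.degree w).image fun z => c s(v, z) := by
    intro b hb
    obtain ⟨z, rfl, hz⟩ := hnbr_of_mem b hb
    exact Finset.mem_image_of_mem _ hz
  have h := (Finset.card_le_card hsub).trans Finset.card_image_le
  omega
end

section
/- Let G be an acyclically edge (Δ(G)+2)-critical finite simple graph and let v be a vertex of G. If v has at least one neighbor of degree 2, then the number of neighbors of v of degree 2 plus the number of neighbors of v of degree 3 is at most Δ(G) − 3. -/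
open SimpleGraph

section Extension

variable {V α : Type*} {G : SimpleGraph V} {x v w : V}

/-- The recoloring `c` with `x v` given color `b` and `x w` given color `a`. -/
def recolorTwo {V α : Type*} [DecidableEq V] (c : Sym2 V → α) (x v w : V) (a b : α) :
    Sym2 V → α :=
  fun e => if e = s(x, v) then b else if e = s(x, w) then a else c e

lemma recolorTwo_left [DecidableEq V] (c : Sym2 V → α) (x v w : V) (a b : α) :
    recolorTwo c x v w a b s(x, v) = b := by
  simp [recolorTwo]

lemma recolorTwo_right [DecidableEq V] (c : Sym2 V → α) (hvw : v ≠ w) (a b : α) :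
    recolorTwo c x v w a b s(x, w) = a := by
  have : s(x, w) ≠ s(x, v) := by
    exact fun h => hvw (Sym2.congr_right.1 h).symm
  simp [recolorTwo, this]

lemma recolorTwo_of_notMem [DecidableEq V] (c : Sym2 V → α) {e : Sym2 V} (he : x ∉ e) (a b : α) :
    recolorTwo c x v w a b e = c e := by
  have h1 : e ≠ s(x, v) := by rintro rfl; simp at he
  have h2 : e ≠ s(x, w) := by rintro rfl; simp at he
  simp [recolorTwo, h1, h2]

lemma mem_edgeSet_deleteEdges_of_notMem {e : Sym2 V} (he : e ∈ G.edgeSet) (hx : x ∉ e) :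
    e ∈ (G.deleteEdges {s(x, w)}).edgeSet := by
  rw [edgeSet_deleteEdges]
  refine ⟨he, ?_⟩
  rintro rfl
  simp at hx

lemma isProperEdgeColoring_recolorTwo [DecidableEq V] (hN : ∀ y, G.Adj x y ↔ y = v ∨ y = w) (hvw : v ≠ w)
    {c : Sym2 V → α} (hc : IsProperEdgeColoring (G.deleteEdges {s(x, w)}) c) {a b : α}
    (ha : ∀ y, G.Adj w y → y ≠ x → c s(w, y) ≠ a)
    (hb : ∀ y, G.Adj v y → y ≠ x → c s(v, y) ≠ b) (hab : a ≠ b) :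
    IsProperEdgeColoring G (recolorTwo c x v w a b) := by
  have key : ∀ e ∈ G.edgeSet, x ∈ e → e = s(x, v) ∨ e = s(x, w) := by
    intro e he hx
    obtain ⟨y, rfl⟩ := hx
    rcases (hN y).1 he with rfl | rfl <;> simp
  have hv : ∀ e ∈ G.edgeSet, x ∉ e → (∃ u, u ∈ s(x, v) ∧ u ∈ e) → c e ≠ b := by
    rintro e he hx ⟨u, hu, hue⟩
    rcases Sym2.mem_iff.1 hu with rfl | rfl
    · exact absurd hue hx
    · obtain ⟨y, rfl⟩ := hue
      exact hb y he (by rintro rfl; simp at hx)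
  have hw : ∀ e ∈ G.edgeSet, x ∉ e → (∃ u, u ∈ s(x, w) ∧ u ∈ e) → c e ≠ a := by
    rintro e he hx ⟨u, hu, hue⟩
    rcases Sym2.mem_iff.1 hu with rfl | rfl
    · exact absurd hue hx
    · obtain ⟨y, rfl⟩ := hue
      exact ha y he (by rintro rfl; simp at hx)
  intro e₁ h₁ e₂ h₂ hne hsh
  have hsh' : ∃ u, u ∈ e₂ ∧ u ∈ e₁ := hsh.imp fun _ h => h.symm
  by_cases hx₁ : x ∈ e₁ <;> by_cases hx₂ : x ∈ e₂
  · rcases key e₁ h₁ hx₁ with rfl | rfl <;> rcases key e₂ h₂ hx₂ with rfl | rfl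
    · exact absurd rfl hne
    · rw [recolorTwo_left, recolorTwo_right c hvw]; exact hab.symm
    · rw [recolorTwo_left, recolorTwo_right c hvw]; exact hab
    · exact absurd rfl hne
  · rw [recolorTwo_of_notMem c hx₂]
    rcases key e₁ h₁ hx₁ with rfl | rfl
    · rw [recolorTwo_left]; exact (hv e₂ h₂ hx₂ hsh).symm
    · rw [recolorTwo_right c hvw]; exact (hw e₂ h₂ hx₂ hsh).symm
  · rw [recolorTwo_of_notMem c hx₁]
    rcases key e₂ h₂ hx₂ with rfl | rfl
    · rw [recolorTwo_left]; exact hv e₁ h₁ hx₁ hsh'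
    · rw [recolorTwo_right c hvw]; exact hw e₁ h₁ hx₁ hsh'
  · rw [recolorTwo_of_notMem c hx₁, recolorTwo_of_notMem c hx₂]
    exact hc e₁ (mem_edgeSet_deleteEdges_of_notMem h₁ hx₁) e₂
      (mem_edgeSet_deleteEdges_of_notMem h₂ hx₂) hne hsh

/-- A properly colored cycle through `x`, `v` that ends with `w`, and uses only two colors,
continues from `v` with the color of `x w` and then the color of `x v`. -/
lemma exists_alternating_of_isCycle {c : Sym2 V → α} (hc : IsProperEdgeColoring G c)
    {p : G.Walk x x} (hp : p.IsCycle) (hsnd : p.snd = v) (hpen : p.penultimate = w)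
    (hvw : G.Adj v w → c s(v, w) ≠ c s(x, w)) {α₁ α₂ : α}
    (hcol : ∀ e ∈ p.edges, c e = α₁ ∨ c e = α₂) :
    ∃ u y, G.Adj v u ∧ u ≠ x ∧ u ≠ w ∧ c s(v, u) = c s(x, w) ∧ G.Adj u y ∧
      c s(u, y) = c s(x, v) := by
  have hlen := hp.three_le_length
  have hinj := hp.getVert_injOn'
  have h0 : p.getVert 0 = x := p.getVert_zero
  have h1 : p.getVert 1 = v := hsnd
  have hn : p.getVert (p.length - 1) = w := hpen
  have hmem : ∀ i < p.length, s(p.getVert i, p.getVert (i + 1)) ∈ p.edges := fun i hi =>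
    p.mk_mem_edges_iff_exists.2 ⟨i, hi, rfl⟩
  have hne : ∀ i j, i < p.length → j < p.length → i ≠ j → p.getVert i ≠ p.getVert j := by
    intro i j hi hj hij h
    exact hij (hinj (by simp; omega) (by simp; omega) h)
  have hadj : ∀ i < p.length, G.Adj (p.getVert i) (p.getVert (i + 1)) := fun i hi =>
    p.adj_getVert_succ hi
  have a1 := hadj 0 (by omega)
  have a2 := hadj 1 (by omega)
  have e1 := hcol _ (hmem 0 (by omega))
  have e2 := hcol _ (hmem 1 (by omega))
  have el := hcol _ (hmem (p.length - 1) (by omega))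
  have al := hadj (p.length - 1) (by omega)
  have hl : p.length - 1 + 1 = p.length := by omega
  simp only [zero_add, Nat.reduceAdd, h0, h1] at a1 a2 e1 e2
  rw [hl, hn, p.getVert_length, Sym2.eq_swap] at el
  rw [hl, hn, p.getVert_length] at al
  have n2 : p.getVert 2 ≠ x := fun h => hne 2 0 (by omega) (by omega) (by omega) (h.trans h0.symm)
  have hvw' : v ≠ w := by
    rw [← h1, ← hn]; exact hne 1 _ (by omega) (by omega) (by omega)
  have hxw : c s(x, v) ≠ c s(x, w) :=
    hc _ a1 _ al.symm (fun h => hvw' (Sym2.congr_right.1 h)) ⟨x, by simp, by simp⟩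
  have h12 : c s(x, v) ≠ c s(v, p.getVert 2) :=
    hc _ a1 _ a2 (by
      rw [Sym2.eq_swap]; exact fun h => n2 (Sym2.congr_right.1 h).symm) ⟨v, by simp, by simp⟩
  have hu : c s(v, p.getVert 2) = c s(x, w) := by grind
  have n2w : p.getVert 2 ≠ w := by
    intro h
    rw [h] at hu a2
    exact hvw a2 hu
  have hlen4 : 3 < p.length := by
    by_contra hcon
    have : p.length - 1 = 2 := by omega
    rw [this] at hn
    exact n2w hn
  have a3 := hadj 2 (by omega)
  have e3 := hcol _ (hmem 2 (by omega))
  have n31 : p.getVert 3 ≠ v := fun h => hne 3 1 (by omega) (by omega) (by omega) (h.trans h1.symm)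
  have h23 : c s(v, p.getVert 2) ≠ c s(p.getVert 2, p.getVert 3) :=
    hc _ a2 _ a3 (by
      rw [Sym2.eq_swap]
      intro h
      rcases Sym2.eq_iff.1 h with ⟨-, h⟩ | ⟨h, -⟩
      · exact n31 h.symm
      · exact a3.ne h) ⟨p.getVert 2, by simp, by simp⟩
  exact ⟨p.getVert 2, p.getVert 3, a2, n2, n2w, hu, a3, by grind⟩

lemma exists_alternating_of_not_isAcyclic [DecidableEq V] (hN : ∀ y, G.Adj x y ↔ y = v ∨ y = w) (hvw : v ≠ w)
    {c : Sym2 V → α} (hc : IsAcyclicEdgeColoring (G.deleteEdges {s(x, w)}) c) {a b : α}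
    (ha : ∀ y, G.Adj w y → y ≠ x → c s(w, y) ≠ a)
    (hb : ∀ y, G.Adj v y → y ≠ x → c s(v, y) ≠ b) (hab : a ≠ b)
    (hnot : ∀ c' : Sym2 V → α, ¬ IsAcyclicEdgeColoring G c') :
    ∃ u y, G.Adj v u ∧ u ≠ x ∧ c s(v, u) = a ∧ G.Adj u y ∧ c s(u, y) = b := by
  have hxv : x ≠ v := ((hN v).2 (Or.inl rfl)).ne
  have hxw : x ≠ w := ((hN w).2 (Or.inr rfl)).ne
  have hproper := isProperEdgeColoring_recolorTwo hN hvw hc.1 ha hb hab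
  by_contra hcon
  refine hnot (recolorTwo c x v w a b) ⟨hproper, ?_⟩
  rintro z p hp ⟨α₁, α₂, hcol⟩
  by_cases hx : x ∈ p.support
  · have main : ∀ q : G.Walk x x, q.IsCycle → q.snd = v → q.penultimate = w →
        (∀ e ∈ q.edges, recolorTwo c x v w a b e = α₁ ∨ recolorTwo c x v w a b e = α₂) →
        False := by
      intro q hq hs hpen hqc
      have hvw_ne : G.Adj v w →
          recolorTwo c x v w a b s(v, w) ≠ recolorTwo c x v w a b s(x, w) := by
        intro h
        rw [recolorTwo_right c hvw, recolorTwo_of_notMem c (by simp [hxv, hxw]), Sym2.eq_swap]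
        exact ha v h.symm hxv.symm
      obtain ⟨u, y, hvu, hux, huw, hcu, huy, hcy⟩ :=
        exists_alternating_of_isCycle hproper hq hs hpen hvw_ne hqc
      have hyx : y ≠ x := by
        rintro rfl
        rcases (hN u).1 huy.symm with h | h
        · exact hvu.ne h.symm
        · exact huw h
      rw [recolorTwo_right c hvw, recolorTwo_of_notMem c (by simp [hxv, hux.symm])] at hcu
      rw [recolorTwo_left, recolorTwo_of_notMem c (by simp [hyx.symm, hux.symm])] at hcy
      exact hcon ⟨u, y, hvu, hux, hcu, huy, hcy⟩
    have hq := hp.rotate hx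
    have hqc : ∀ e ∈ (p.rotate x hx).edges,
        recolorTwo c x v w a b e = α₁ ∨ recolorTwo c x v w a b e = α₂ := fun e he =>
      hcol e ((p.rotate_edges x hx).mem_iff.1 he)
    generalize p.rotate x hx = q at hq hqc
    have hne := hq.snd_ne_penultimate
    have hs := (hN _).1 (q.adj_snd hq.not_nil)
    have hpen := (hN _).1 (q.adj_penultimate hq.not_nil).symm
    rcases hs with hs | hs
    · refine main q hq hs ?_ hqc
      exact hpen.resolve_left fun h => hne (hs.trans h.symm)
    · have hpen' := hpen.resolve_right fun h => hne (hs.trans h.symm)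
      exact main q.reverse hq.reverse (by simpa using hpen') (by simpa using hs)
        fun e he => hqc e (by simpa using he)
  · have hxe : ∀ e ∈ p.edges, x ∉ e := fun e he hxe =>
      hx (p.mem_support_of_mem_edges he hxe)
    have hH : ∀ e ∈ p.edges, e ∈ (G.deleteEdges {s(x, w)}).edgeSet := fun e he =>
      mem_edgeSet_deleteEdges_of_notMem (p.edges_subset_edgeSet he) (hxe e he)
    refine hc.2 z (p.transfer _ hH) (hp.transfer hH) ⟨α₁, α₂, fun e he => ?_⟩
    rw [Walk.edges_transfer] at he
    have := hcol e he
    rwa [recolorTwo_of_notMem c (hxe e he)] at this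

end Extension

lemma three_le_card_missing_colors {V : Type*} [Fintype V] [DecidableEq V] (G : SimpleGraph V)
    [DecidableRel G.Adj] {x z : V} (hzx : G.Adj z x) (c : Sym2 V → Fin (G.maxDegree + 2)) :
    3 ≤ (((G.neighborFinset z).erase x).image fun y => c s(z, y))ᶜ.card := by
  have h1 : (((G.neighborFinset z).erase x).image fun y => c s(z, y)).card ≤ G.degree z - 1 := by
    refine Finset.card_image_le.trans ?_
    rw [Finset.card_erase_of_mem (by simpa using hzx), card_neighborFinset_eq_degree]
  have h2 := G.degree_le_maxDegree z
  have h3 : 0 < G.degree z := (G.degree_pos_iff_exists_adj z).2 ⟨x, hzx⟩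
  rw [Finset.card_compl, Fintype.card_fin]
  omega

/-- In an acyclically edge `(Δ + 2)`-critical graph, a vertex with a neighbor of degree two has
at least three neighbors of degree at least four. -/
lemma three_le_card_neighbors_degree_ge_four {V : Type*} [Fintype V] [DecidableEq V]
    (G : SimpleGraph V) [DecidableRel G.Adj]
    (hG : IsAcyclicallyEdgeCritical G (G.maxDegree + 2)) {v x : V} (hvx : G.Adj v x)
    (hx : G.degree x = 2) :
    3 ≤ ((G.neighborFinset v).filter fun u => 4 ≤ G.degree u).card := by
  obtain ⟨w, hvw, hN⟩ : ∃ w, v ≠ w ∧ ∀ y, G.Adj x y ↔ y = v ∨ y = w := by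
    rw [← card_neighborFinset_eq_degree, Finset.card_eq_two] at hx
    obtain ⟨r, s, hrs, h⟩ := hx
    have hadj : ∀ y, G.Adj x y ↔ y = r ∨ y = s := fun y => by
      rw [← mem_neighborFinset, h]; simp
    rcases (hadj v).1 hvx.symm with rfl | rfl
    · exact ⟨s, hrs, hadj⟩
    · exact ⟨r, hrs.symm, fun y => (hadj y).trans or_comm⟩
  have hxw : G.Adj x w := (hN w).2 (Or.inr rfl)
  have hlt : G.deleteEdges {s(x, w)} < G := by
    refine lt_of_le_of_ne (deleteEdges_le _) fun h => ?_
    have : (G.deleteEdges {s(x, w)}).Adj x w := by rw [h]; exact hxw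
    simp at this
  obtain ⟨c, hc⟩ := hG.2 _ hlt
  have hnot : ∀ c', ¬ IsAcyclicEdgeColoring G c' := fun c' h => hG.1 ⟨c', h⟩
  set A := (((G.neighborFinset w).erase x).image fun y => c s(w, y))ᶜ with hA
  set B := (((G.neighborFinset v).erase x).image fun y => c s(v, y))ᶜ with hB
  have hA3 : 3 ≤ A.card := three_le_card_missing_colors G hxw.symm c
  have hB3 : 3 ≤ B.card := three_le_card_missing_colors G hvx c
  have hmemA : ∀ a ∈ A, ∀ y, G.Adj w y → y ≠ x → c s(w, y) ≠ a := by
    intro a ha y hy hyx h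
    rw [hA, Finset.mem_compl] at ha
    exact ha (Finset.mem_image.2 ⟨y, by simp [hy, hyx], h⟩)
  have hmemB : ∀ b ∈ B, ∀ y, G.Adj v y → y ≠ x → c s(v, y) ≠ b := by
    intro b hb y hy hyx h
    rw [hB, Finset.mem_compl] at hb
    exact hb (Finset.mem_image.2 ⟨y, by simp [hy, hyx], h⟩)
  have key : ∀ a ∈ A, ∀ b ∈ B, a ≠ b →
      ∃ u y, G.Adj v u ∧ u ≠ x ∧ c s(v, u) = a ∧ G.Adj u y ∧ c s(u, y) = b :=
    fun a ha b hb hab => exists_alternating_of_not_isAcyclic hN hvw hc (hmemA a ha) (hmemB b hb)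
      hab hnot
  have hAB : ∀ a ∈ A, a ∉ B := by
    intro a ha haB
    obtain ⟨b, hb, hba⟩ := Finset.exists_mem_ne (by omega : 1 < B.card) a
    obtain ⟨u, -, hvu, hux, hcu, -⟩ := key a ha b hb hba.symm
    exact hmemB a haB u hvu hux hcu
  have hsub : A ⊆ ((G.neighborFinset v).filter fun u => 4 ≤ G.degree u).image
      fun u => c s(v, u) := by
    intro a ha
    obtain ⟨b₀, hb₀⟩ := Finset.card_pos.1 (by omega : 0 < B.card)
    obtain ⟨u, -, hvu, hux, hcu, -⟩ := key a ha b₀ hb₀ fun h => hAB a ha (h ▸ hb₀)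
    have hdel : ∀ z, G.Adj v z → z ≠ x →
        s(v, z) ∈ (G.deleteEdges {s(x, w)}).edgeSet := fun z hz hzx =>
      mem_edgeSet_deleteEdges_of_notMem hz (by simp [hvx.ne', hzx.symm])
    have hins : insert a B ⊆ (G.neighborFinset u).image fun y => c s(u, y) := by
      intro b hb
      rcases Finset.mem_insert.1 hb with rfl | hb
      · exact Finset.mem_image.2 ⟨v, by simpa using hvu.symm, by rw [Sym2.eq_swap]; exact hcu⟩
      · obtain ⟨u', y, hvu', hux', hcu', huy, hcy⟩ := key a ha b hb fun h => hAB a ha (h ▸ hb)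
        have huu' : u' = u := by
          by_contra hne
          refine hc.1 _ (hdel u' hvu' hux') _ (hdel u hvu hux) ?_ ⟨v, by simp, by simp⟩
            (hcu'.trans hcu.symm)
          exact fun h => hne (Sym2.congr_right.1 h)
        subst huu'
        exact Finset.mem_image.2 ⟨y, by simpa using huy, hcy⟩
    have hcard := (Finset.card_le_card hins).trans Finset.card_image_le
    rw [Finset.card_insert_of_notMem (hAB a ha), card_neighborFinset_eq_degree] at hcard
    exact Finset.mem_image.2 ⟨u, by simp [hvu]; omega, hcu⟩
  exact hA3.trans ((Finset.card_le_card hsub).trans Finset.card_image_le)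

theorem stmt8 {V : Type*} [Fintype V] [DecidableEq V] (G : SimpleGraph V) [DecidableRel G.Adj]
    (hG : IsAcyclicallyEdgeCritical G (G.maxDegree + 2)) (v : V)
    (h2 : ((G.neighborFinset v).filter fun w => G.degree w = 2).card ≠ 0) :
    ((G.neighborFinset v).filter fun w => G.degree w = 2).card +
      ((G.neighborFinset v).filter fun w => G.degree w = 3).card ≤ G.maxDegree - 3 := by
  obtain ⟨x, hx⟩ := Finset.card_ne_zero.1 h2
  rw [Finset.mem_filter, mem_neighborFinset] at hx
  have h4 := three_le_card_neighbors_degree_ge_four G hG hx.1 hx.2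
  have hd := G.degree_le_maxDegree v
  have hsum : ((G.neighborFinset v).filter fun w => G.degree w = 2).card +
      ((G.neighborFinset v).filter fun w => G.degree w = 3).card +
      ((G.neighborFinset v).filter fun w => 4 ≤ G.degree w).card ≤ G.degree v := by
    rw [← Finset.card_union_of_disjoint, ← Finset.card_union_of_disjoint,
      ← card_neighborFinset_eq_degree]
    · exact Finset.card_le_card (by grind)
    · exact Finset.disjoint_left.2 (by grind)
    · exact Finset.disjoint_left.2 (by grind)
  omega
end

section
/- Let G be an acyclically edge (Δ(G)+2)-critical finite simple graph, and let v be a vertex of degree 3 with neighbors x, y, z. If x has degree 4, then both y and z have degree at least 5. -/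
open SimpleGraph

namespace AcyclicEdgeColoring

variable {V α : Type*}

section Graph

variable {M : SimpleGraph V}

/-- In a graph of maximum degree at most two, the end of a path that continues an edge `w a`
and stops at a vertex of degree at most one is determined by `w` and `a`. -/
lemma path_end_unique_aux (hM : ∀ u w₁ w₂ w₃, M.Adj u w₁ → M.Adj u w₂ → M.Adj u w₃ →
      w₁ = w₂ ∨ w₁ = w₃ ∨ w₂ = w₃)
    {a b : V} (p : M.Walk a b) (hp : p.IsPath) (hb : ∀ w₁ w₂, M.Adj b w₁ → M.Adj b w₂ → w₁ = w₂)
    {w d : V} (hwa : M.Adj a w) (hwp : w ∉ p.support)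
    (hd : ∀ w₁ w₂, M.Adj d w₁ → M.Adj d w₂ → w₁ = w₂)
    (q : M.Walk a d) (hq : q.IsPath) (hwq : w ∉ q.support) : b = d := by
  induction p generalizing w with
  | nil =>
    cases q with
    | nil => rfl
    | cons h q' =>
      have := hb _ _ hwa h
      subst this
      simp at hwq
  | @cons a u b h p' ih =>
    rw [Walk.cons_isPath_iff] at hp
    have hup : w ≠ u := fun e => hwp (by
      rw [Walk.support_cons, e]; exact List.mem_cons_of_mem _ p'.start_mem_support)
    cases q with
    | nil => exact absurd (hd _ _ hwa h) hup
    | @cons _ u' _ h' q' =>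
      rw [Walk.cons_isPath_iff] at hq
      have huq : w ≠ u' := fun e => hwq (by
        rw [Walk.support_cons, e]; exact List.mem_cons_of_mem _ q'.start_mem_support)
      have key := ((hM _ _ _ _ hwa h h').resolve_left hup).resolve_left huq
      subst key
      exact ih hp.1 hb h.symm hp.2 q' hq.1 hq.2

/-- In a graph of maximum degree at most two, a connected component has at most two vertices
of degree at most one. -/
lemma not_reachable_of_three_ends (hM : ∀ u w₁ w₂ w₃, M.Adj u w₁ → M.Adj u w₂ → M.Adj u w₃ →
      w₁ = w₂ ∨ w₁ = w₃ ∨ w₂ = w₃) {a b d : V}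
    (ha : ∀ w₁ w₂, M.Adj a w₁ → M.Adj a w₂ → w₁ = w₂)
    (hb : ∀ w₁ w₂, M.Adj b w₁ → M.Adj b w₂ → w₁ = w₂)
    (hd : ∀ w₁ w₂, M.Adj d w₁ → M.Adj d w₂ → w₁ = w₂)
    (hab : a ≠ b) (had : a ≠ d) (hbd : b ≠ d) (h : M.Reachable a b) : ¬ M.Reachable a d := by
  intro h'
  obtain ⟨p, hp⟩ := h.exists_isPath
  obtain ⟨q, hq⟩ := h'.exists_isPath
  cases p with
  | nil => exact hab rfl
  | cons e p' =>
    cases q with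
    | nil => exact had rfl
    | cons e' q' =>
      rw [Walk.cons_isPath_iff] at hp hq
      have := ha _ _ e e'
      subst this
      exact hbd (path_end_unique_aux hM p' hp.1 hb e.symm hp.2 hd q' hq.1 hq.2)

lemma isAcyclic_of_leaf {M' : SimpleGraph V} (hM : M.IsAcyclic) {p q : V}
    (hleaf : ∀ w, M'.Adj p w → w = q)
    (hle : ∀ u w, M'.Adj u w → s(u, w) ≠ s(p, q) → M.Adj u w) : M'.IsAcyclic := by
  rcases eq_or_ne p q with rfl | hpq
  · refine hM.anti fun u w h => hle u w h fun e => ?_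
    rw [Sym2.eq_iff] at e
    rcases e with ⟨rfl, rfl⟩ | ⟨rfl, rfl⟩ <;> exact h.ne rfl
  have hN : (M'.deleteEdges {s(p, q)}).IsAcyclic :=
    hM.anti fun u w h => by
      rw [deleteEdges_adj] at h
      exact hle u w h.1 h.2
  have hr : ¬ (M'.deleteEdges {s(p, q)}).Reachable p q := by
    rintro ⟨w⟩
    cases w with
    | nil => exact hpq rfl
    | cons h _ =>
      rw [deleteEdges_adj] at h
      exact h.2 (by rw [hleaf _ h.1]; rfl)
  refine (hN.sup_edge_of_not_reachable hr).anti fun u w h => ?_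
  rw [sup_adj, deleteEdges_adj, edge_adj]
  by_cases e : s(u, w) = s(p, q)
  · exact Or.inr ⟨by simpa using e, h.ne⟩
  · exact Or.inl ⟨h, e⟩

lemma isAcyclic_sup_two_edges (hM : M.IsAcyclic) {v p q : V} (hv : ∀ w, ¬ M.Adj v w)
    (hp : v ≠ p) (hq : v ≠ q) (h : ¬ M.Reachable p q) :
    (M ⊔ edge v p ⊔ edge v q).IsAcyclic := by
  have hv' : ∀ u, v ≠ u → ¬ M.Reachable v u := by
    rintro u hu ⟨w⟩
    cases w with
    | nil => exact hu rfl
    | cons h _ => exact hv _ h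
  refine (hM.sup_edge_of_not_reachable (hv' p hp)).sup_edge_of_not_reachable ?_
  have key : ∀ u w, (M ⊔ edge v p).Walk u w → M.Reachable u q → M.Reachable w q := by
    intro u w r
    induction r with
    | nil => exact id
    | cons e _ ih =>
      intro hu
      refine ih ?_
      rw [sup_adj, edge_adj] at e
      rcases e with e | ⟨⟨rfl, rfl⟩ | ⟨rfl, rfl⟩, _⟩
      · exact e.symm.reachable.trans hu
      · exact absurd hu (hv' q hq)
      · exact absurd hu h
  rintro ⟨r⟩
  exact hv' q hq (key _ _ r.reverse (Reachable.refl q))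

end Graph

/-- The spanning subgraph of `H` formed by the edges colored `a` or `b`. -/
def bichromatic (H : SimpleGraph V) (c : Sym2 V → α) (a b : α) : SimpleGraph V where
  Adj u w := H.Adj u w ∧ (c s(u, w) = a ∨ c s(u, w) = b)
  symm := ⟨fun u w h => by rw [Sym2.eq_swap]; exact ⟨h.1.symm, h.2⟩⟩
  loopless := ⟨fun u h => h.1.ne rfl⟩

/-- The colors of the edges of `H` at the vertex `u`. -/
def colorsAt (H : SimpleGraph V) (c : Sym2 V → α) (u : V) : Set α :=
  {a | ∃ w, H.Adj u w ∧ c s(u, w) = a}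

section Bichromatic

variable {H : SimpleGraph V} {c : Sym2 V → α} {a b : α} {u w : V}

lemma bichromatic_adj :
    (bichromatic H c a b).Adj u w ↔ H.Adj u w ∧ (c s(u, w) = a ∨ c s(u, w) = b) := Iff.rfl

lemma bichromatic_comm (H : SimpleGraph V) (c : Sym2 V → α) (a b : α) :
    bichromatic H c a b = bichromatic H c b a := by
  ext u w
  simp only [bichromatic_adj, or_comm]

lemma bichromatic_le : bichromatic H c a b ≤ H := fun _ _ h => h.1

lemma mem_colorsAt (h : H.Adj u w) : c s(u, w) ∈ colorsAt H c u := ⟨w, h, rfl⟩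

lemma mem_colorsAt' (h : H.Adj u w) : c s(u, w) ∈ colorsAt H c w :=
  ⟨u, h.symm, by rw [Sym2.eq_swap]⟩

lemma isAcyclicEdgeColoring_iff : IsAcyclicEdgeColoring H c ↔
    (∀ u w w', H.Adj u w → H.Adj u w' → c s(u, w) = c s(u, w') → w = w') ∧
      ∀ a b, (bichromatic H c a b).IsAcyclic := by
  constructor
  · rintro ⟨hp, hc⟩
    refine ⟨fun u w w' h h' e => ?_, fun a b v w hw => ?_⟩
    · by_contra hne
      refine hp _ h _ h' (fun e' => hne ?_) ⟨u, by simp, by simp⟩ e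
      exact Sym2.congr_right.1 e'
    · refine hc v (w.mapLe bichromatic_le) (hw.mapLe bichromatic_le) ⟨a, b, fun e he => ?_⟩
      rw [Walk.edges_mapLe_eq_edges] at he
      have := w.edges_subset_edgeSet he
      induction e with
      | _ x y => exact this.2
  · rintro ⟨hp, hc⟩
    refine ⟨fun e₁ h₁ e₂ h₂ hne ⟨u, hu₁, hu₂⟩ e => hne ?_, ?_⟩
    · obtain ⟨w₁, rfl⟩ := Sym2.mem_iff_exists.1 hu₁
      obtain ⟨w₂, rfl⟩ := Sym2.mem_iff_exists.1 hu₂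
      rw [hp u w₁ w₂ h₁ h₂ e]
    · rintro v w hw ⟨a, b, hab⟩
      refine hc a b (w.transfer (bichromatic H c a b) fun e he => ?_) (hw.transfer _)
      have h₁ := w.edges_subset_edgeSet he
      have h₂ := hab e he
      induction e with
      | _ x y => exact ⟨h₁, h₂⟩

/-- A vertex missing one of the colors `a`, `b` has degree at most one in the graph of
edges colored `a` or `b`. -/
lemma bichromatic_adj_unique
    (hc : ∀ u w w', H.Adj u w → H.Adj u w' → c s(u, w) = c s(u, w') → w = w')
    (hu : a ∉ colorsAt H c u ∨ b ∉ colorsAt H c u) (w₁ w₂ : V)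
    (h₁ : (bichromatic H c a b).Adj u w₁) (h₂ : (bichromatic H c a b).Adj u w₂) : w₁ = w₂ := by
  have k₁ := mem_colorsAt (c := c) h₁.1
  have k₂ := mem_colorsAt (c := c) h₂.1
  refine hc u w₁ w₂ h₁.1 h₂.1 ?_
  rcases h₁.2 with e₁ | e₁ <;> rcases h₂.2 with e₂ | e₂ <;> rw [e₁] at k₁ <;> rw [e₂] at k₂ <;>
    rw [e₁, e₂] <;> tauto

lemma bichromatic_not_reachable
    (hc : ∀ u w w', H.Adj u w → H.Adj u w' → c s(u, w) = c s(u, w') → w = w') {p q r : V}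
    (hp : a ∉ colorsAt H c p ∨ b ∉ colorsAt H c p)
    (hq : a ∉ colorsAt H c q ∨ b ∉ colorsAt H c q)
    (hr : a ∉ colorsAt H c r ∨ b ∉ colorsAt H c r)
    (hpq : p ≠ q) (hpr : p ≠ r) (hqr : q ≠ r) (h : (bichromatic H c a b).Reachable p q) :
    ¬ (bichromatic H c a b).Reachable p r := by
  refine not_reachable_of_three_ends (fun u w₁ w₂ w₃ h₁ h₂ h₃ => ?_)
    (bichromatic_adj_unique hc hp) (bichromatic_adj_unique hc hq) (bichromatic_adj_unique hc hr)
    hpq hpr hqr h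
  have k := fun w w' => hc u w w'
  rcases h₁.2 with e₁ | e₁ <;> rcases h₂.2 with e₂ | e₂ <;> rcases h₃.2 with e₃ | e₃
  all_goals first
    | exact Or.inl (k _ _ h₁.1 h₂.1 (e₁.trans e₂.symm))
    | exact Or.inr (Or.inl (k _ _ h₁.1 h₃.1 (e₁.trans e₃.symm)))
    | exact Or.inr (Or.inr (k _ _ h₂.1 h₃.1 (e₂.trans e₃.symm)))

lemma not_reachable_of_notMem (huw : u ≠ w) (ha : a ∉ colorsAt H c u)
    (hb : b ∉ colorsAt H c u) : ¬ (bichromatic H c a b).Reachable u w := by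
  rintro ⟨p⟩
  cases p with
  | nil => exact huw rfl
  | cons h _ =>
    have k := mem_colorsAt (c := c) h.1
    rcases h.2 with e | e <;> rw [e] at k <;> contradiction

/-- The first edge of a path in colors `a`, `s` starting at a vertex `x` missing `a`. -/
lemma exists_first_edge {x : V} {s : α} (hxu : x ≠ u) (ha : a ∉ colorsAt H c x)
    (h : (bichromatic H c a s).Reachable x u) :
    ∃ n, H.Adj x n ∧ c s(x, n) = s ∧ ∃ q : (bichromatic H c a s).Walk n u, x ∉ q.support := by
  obtain ⟨p, hp⟩ := h.exists_isPath
  cases p with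
  | nil => exact absurd rfl hxu
  | cons h q =>
    rw [Walk.cons_isPath_iff] at hp
    refine ⟨_, h.1, h.2.resolve_left fun e => ha ?_, q, hp.2⟩
    rw [← e]
    exact mem_colorsAt h.1

end Bichromatic

section Extension

variable {G : SimpleGraph V} {c c' : Sym2 V → α} {a b d : α} {v x y z : V}

lemma isAcyclic_bichromatic_of_extends
    (hcc : ∀ u w, u ≠ v → w ≠ v → c' s(u, w) = c s(u, w))
    (hN : ∀ w, G.Adj v w → w = x ∨ w = y ∨ w = z) (hx : v ≠ x) (hy : v ≠ y)
    (hne : c' s(v, x) ≠ c' s(v, y)) (hz : c' s(v, z) ≠ a ∧ c' s(v, z) ≠ b)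
    (hac : (bichromatic (G.deleteIncidenceSet v) c a b).IsAcyclic)
    (hr : ¬ (bichromatic (G.deleteIncidenceSet v) c (c' s(v, x)) (c' s(v, y))).Reachable x y) :
    (bichromatic G c' a b).IsAcyclic := by
  have hle : ∀ u w, (bichromatic G c' a b).Adj u w → u ≠ v → w ≠ v →
      (bichromatic (G.deleteIncidenceSet v) c a b).Adj u w := by
    intro u w h hu hw
    refine ⟨deleteIncidenceSet_adj.2 ⟨h.1, hu, hw⟩, ?_⟩
    rw [← hcc u w hu hw]
    exact h.2
  have hN' : ∀ w, (bichromatic G c' a b).Adj v w → w = x ∨ w = y := by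
    intro w h
    rcases hN w h.1 with e | e | e
    · exact Or.inl e
    · exact Or.inr e
    · subst e
      rcases h.2 with e | e
      · exact absurd e hz.1
      · exact absurd e hz.2
  have leaf : ∀ w, (∀ u, (bichromatic G c' a b).Adj v u → u = w) →
      (bichromatic G c' a b).IsAcyclic := by
    intro w hw
    refine isAcyclic_of_leaf hac hw fun u u' h hne => hle u u' h ?_ ?_
    · rintro rfl
      exact hne (by rw [hw _ h])
    · rintro rfl
      exact hne (by rw [hw _ h.symm, Sym2.eq_swap])
  by_cases h₁ : c' s(v, x) = a ∨ c' s(v, x) = b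
  swap
  · refine leaf y fun u hu => (hN' u hu).resolve_left ?_
    rintro rfl
    exact h₁ hu.2
  by_cases h₂ : c' s(v, y) = a ∨ c' s(v, y) = b
  swap
  · refine leaf x fun u hu => (hN' u hu).resolve_right ?_
    rintro rfl
    exact h₂ hu.2
  have hr' : ¬ (bichromatic (G.deleteIncidenceSet v) c a b).Reachable x y := by
    rcases h₁ with e₁ | e₁ <;> rcases h₂ with e₂ | e₂
    · exact absurd (e₁.trans e₂.symm) hne
    · rwa [e₁, e₂] at hr
    · rwa [e₁, e₂, bichromatic_comm] at hr
    · exact absurd (e₁.trans e₂.symm) hne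
  refine (isAcyclic_sup_two_edges hac (v := v)
    (fun w h => (deleteIncidenceSet_adj.1 h.1).2.1 rfl) hx hy hr').anti fun u w h => ?_
  simp only [sup_adj, edge_adj]
  by_cases hu : u = v
  · subst hu
    have := h.ne
    rcases hN' w h with rfl | rfl <;> tauto
  by_cases hw : w = v
  · subst hw
    have := h.ne
    rcases hN' u h.symm with rfl | rfl <;> tauto
  exact Or.inl (Or.inl (hle u w h hu hw))

lemma exists_isAcyclicEdgeColoring_of_extends (hN : ∀ w, G.Adj v w → w = x ∨ w = y ∨ w = z)
    (hx : v ≠ x) (hy : v ≠ y) (hz : v ≠ z) (hxy : x ≠ y) (hxz : x ≠ z) (hyz : y ≠ z)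
    (hc : IsAcyclicEdgeColoring (G.deleteIncidenceSet v) c)
    (hab : a ≠ b) (had : a ≠ d) (hbd : b ≠ d)
    (ha : a ∉ colorsAt (G.deleteIncidenceSet v) c x)
    (hb : b ∉ colorsAt (G.deleteIncidenceSet v) c y)
    (hd : d ∉ colorsAt (G.deleteIncidenceSet v) c z)
    (rxy : ¬ (bichromatic (G.deleteIncidenceSet v) c a b).Reachable x y)
    (rxz : ¬ (bichromatic (G.deleteIncidenceSet v) c a d).Reachable x z)
    (ryz : ¬ (bichromatic (G.deleteIncidenceSet v) c b d).Reachable y z) :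
    ∃ c' : Sym2 V → α, IsAcyclicEdgeColoring G c' := by
  classical
  obtain ⟨c', cx, cy, cz, hcc⟩ : ∃ c' : Sym2 V → α, c' s(v, x) = a ∧ c' s(v, y) = b ∧
      c' s(v, z) = d ∧ ∀ u w, u ≠ v → w ≠ v → c' s(u, w) = c s(u, w) := by
    refine ⟨fun e => if e = s(v, x) then a else if e = s(v, y) then b else
      if e = s(v, z) then d else c e, ?_, ?_, ?_, fun u w hu hw => ?_⟩
    · simp
    · have : s(v, y) ≠ s(v, x) := fun e => hxy (Sym2.congr_right.1 e).symm
      simp [this]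
    · have h₁ : s(v, z) ≠ s(v, x) := fun e => hxz (Sym2.congr_right.1 e).symm
      have h₂ : s(v, z) ≠ s(v, y) := fun e => hyz (Sym2.congr_right.1 e).symm
      simp [h₁, h₂]
    · have : ∀ r, s(u, w) ≠ s(v, r) := by
        intro r e
        have : v ∈ s(u, w) := by rw [e]; simp
        rw [Sym2.mem_iff] at this
        tauto
      simp [this]
  rw [isAcyclicEdgeColoring_iff] at hc
  obtain ⟨hp, hac⟩ := hc
  refine ⟨c', isAcyclicEdgeColoring_iff.2 ⟨?_, fun a' b' => ?_⟩⟩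
  · have hv : ∀ u w, G.Adj u v → w ≠ v → G.Adj u w → c' s(u, v) ≠ c' s(u, w) := by
      intro u w huv hw huw e
      have k : c s(u, w) ∈ colorsAt (G.deleteIncidenceSet v) c u :=
        mem_colorsAt (deleteIncidenceSet_adj.2 ⟨huw, huv.ne, hw⟩)
      rw [← hcc u w huv.ne hw, ← e, Sym2.eq_swap] at k
      rcases hN u huv.symm with rfl | rfl | rfl
      · rw [cx] at k; exact ha k
      · rw [cy] at k; exact hb k
      · rw [cz] at k; exact hd k
    intro u w w' h h' e
    by_cases hu : u = v
    · subst hu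
      rcases hN w h with rfl | rfl | rfl <;> rcases hN w' h' with rfl | rfl | rfl <;>
        first
        | rfl
        | (simp only [cx, cy, cz] at e; first | exact absurd e ‹_› | exact absurd e.symm ‹_›)
    by_cases hw : w = v
    · subst hw
      by_contra hne
      exact hv u w' h (Ne.symm hne) h' e
    by_cases hw' : w' = v
    · subst hw'
      exact absurd e.symm (hv u w h' hw h)
    rw [hcc u w hu hw, hcc u w' hu hw'] at e
    exact hp u w w' (deleteIncidenceSet_adj.2 ⟨h, hu, hw⟩)
      (deleteIncidenceSet_adj.2 ⟨h', hu, hw'⟩) e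
  · by_cases kz : d ≠ a' ∧ d ≠ b'
    · exact isAcyclic_bichromatic_of_extends (z := z) hcc hN hx hy (by rwa [cx, cy])
        (by rwa [cz]) (hac a' b') (by rwa [cx, cy])
    by_cases ky : b ≠ a' ∧ b ≠ b'
    · exact isAcyclic_bichromatic_of_extends (z := y) hcc (fun w h => by
          rcases hN w h with h | h | h <;> tauto) hx hz (by rwa [cx, cz])
        (by rwa [cy]) (hac a' b') (by rwa [cx, cz])
    · have kx : a ≠ a' ∧ a ≠ b' := by
        constructor <;> rintro rfl <;> grind
      exact isAcyclic_bichromatic_of_extends (z := x) hcc (fun w h => by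
          rcases hN w h with h | h | h <;> tauto) hy hz (by rwa [cy, cz])
        (by rwa [cx]) (hac a' b') (by rwa [cy, cz])

end Extension

section Swap

variable {H : SimpleGraph V} {c : Sym2 V → α} {x : V} {s : α} {X : Finset α}

lemma mem_colorsAt_of_reachable
    (hc : ∀ u w w', H.Adj u w → H.Adj u w' → c s(u, w) = c s(u, w') → w = w')
    (hX : ∀ a ∈ colorsAt H c x, a ∈ X)
    (hs : ∀ a, a ∉ X → ∃ u, u ≠ x ∧ s ∉ colorsAt H c u ∧ (bichromatic H c a s).Reachable x u)
    {w : V} (hxw : H.Adj x w) (hw : c s(x, w) = s) {a : α} (ha : a ∉ X) :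
    a ∈ colorsAt H c w := by
  obtain ⟨u, hux, hsu, hr⟩ := hs a ha
  obtain ⟨n, hxn, hn, q, hq⟩ := exists_first_edge hux.symm (fun h => ha (hX a h)) hr
  obtain rfl := hc x n w hxn hxw (hn.trans hw.symm)
  cases q with
  | nil =>
    refine absurd ?_ hsu
    rw [← hw]
    exact mem_colorsAt' hxw
  | @cons _ m _ h q' =>
    have k := mem_colorsAt (c := c) h.1
    rcases h.2 with e | e
    · rwa [e] at k
    · refine absurd ?_ hq
      have : m = x := hc _ m x h.1 hxw.symm (by rw [e, Sym2.eq_swap, hw])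
      subst this
      exact List.mem_cons_of_mem _ q'.start_mem_support

lemma colorsAt_eq_of_reachable [Fintype α] [DecidableEq α] {D : ℕ} (hD : D + 2 = Fintype.card α)
    (hdeg : ∀ u, (colorsAt H c u).ncard ≤ D) (hX3 : X.card = 3)
    (hc : ∀ u w w', H.Adj u w → H.Adj u w' → c s(u, w) = c s(u, w') → w = w')
    (hX : ∀ a ∈ colorsAt H c x, a ∈ X)
    (hs : ∀ a, a ∉ X → ∃ u, u ≠ x ∧ s ∉ colorsAt H c u ∧ (bichromatic H c a s).Reachable x u)
    (hsX : s ∈ X) {w : V} (hxw : H.Adj x w) (hw : c s(x, w) = s) :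
    colorsAt H c w = (insert s Xᶜ : Finset α) := by
  symm
  refine Set.eq_of_subset_of_ncard_le ?_ ?_
  · intro a ha
    rw [Finset.mem_coe, Finset.mem_insert, Finset.mem_compl] at ha
    rcases ha with rfl | ha
    · rw [← hw]; exact mem_colorsAt' hxw
    · exact mem_colorsAt_of_reachable hc hX hs hxw hw ha
  · have h₁ := hdeg w
    rw [Set.ncard_coe_finset, Finset.card_insert_of_notMem (by simpa using hsX),
      Finset.card_compl]
    omega

lemma reachable_of_eq_off {c' : Sym2 V → α} {a b : α}
    (hcc : ∀ u w, u ≠ x → w ≠ x → c' s(u, w) = c s(u, w)) {u w : V}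
    (p : (bichromatic H c a b).Walk u w) (hp : x ∉ p.support) :
    (bichromatic H c' a b).Reachable u w := by
  induction p with
  | nil => exact Reachable.refl _
  | @cons u n w h p ih =>
    rw [Walk.support_cons, List.mem_cons, not_or] at hp
    refine Reachable.trans (Adj.reachable ?_) (ih hp.2)
    refine ⟨h.1, ?_⟩
    rw [hcc u n (Ne.symm hp.1) (by rintro rfl; exact hp.2 p.start_mem_support)]
    exact h.2

/-- Two colors at a vertex `x` from which many bichromatic paths start can be interchanged. -/
lemma exists_swap [Fintype α] [DecidableEq α] {D : ℕ} {t : α} (hD : D + 2 = Fintype.card α)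
    (hdeg : ∀ u, (colorsAt H c u).ncard ≤ D) (hX3 : X.card = 3)
    (hc : IsAcyclicEdgeColoring H c) (hX : ∀ a ∈ colorsAt H c x, a ∈ X)
    (hs : ∀ a, a ∉ X → ∃ u, u ≠ x ∧ s ∉ colorsAt H c u ∧ (bichromatic H c a s).Reachable x u)
    (ht : ∀ a, a ∉ X → ∃ u, u ≠ x ∧ t ∉ colorsAt H c u ∧ (bichromatic H c a t).Reachable x u)
    (hsX : s ∈ X) (htX : t ∈ X) (hst : s ≠ t) :
    ∃ c', IsAcyclicEdgeColoring H c' ∧ (∀ a ∈ colorsAt H c' x, a ∈ X) ∧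
      (∀ u, u ≠ x → (colorsAt H c u).ncard < D → colorsAt H c' u ⊆ colorsAt H c u) ∧
      (∀ a b, a ≠ s → a ≠ t → b ≠ s → b ≠ t → bichromatic H c' a b = bichromatic H c a b) ∧
      ∀ a, a ∉ X → ∀ u w, u ≠ x → (colorsAt H c u).ncard < D → s ∉ colorsAt H c u →
        (bichromatic H c a s).Reachable x u → w ≠ u → (w = x ∨ (colorsAt H c w).ncard < D ∧
          (a ∉ colorsAt H c w ∨ s ∉ colorsAt H c w)) →
        ¬ (bichromatic H c' a s).Reachable w u := by
  obtain ⟨hp, hac⟩ := isAcyclicEdgeColoring_iff.1 hc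
  have fs : ∀ w, H.Adj x w → c s(x, w) = s → colorsAt H c w = (insert s Xᶜ : Finset α) :=
    fun w => colorsAt_eq_of_reachable hD hdeg hX3 hp hX hs hsX
  have ft : ∀ w, H.Adj x w → c s(x, w) = t → colorsAt H c w = (insert t Xᶜ : Finset α) :=
    fun w => colorsAt_eq_of_reachable hD hdeg hX3 hp hX ht htX
  have full : ∀ r ∈ X, (((insert r Xᶜ : Finset α) : Set α)).ncard = D := by
    intro r hr
    rw [Set.ncard_coe_finset, Finset.card_insert_of_notMem (by simpa using hr), Finset.card_compl]
    have := Finset.card_le_univ X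
    omega
  obtain ⟨c', hx', hcc⟩ : ∃ c' : Sym2 V → α, (∀ w, c' s(x, w) = Equiv.swap s t (c s(x, w))) ∧
      ∀ u w, u ≠ x → w ≠ x → c' s(u, w) = c s(u, w) := by
    classical
    refine ⟨fun e => if x ∈ e then Equiv.swap s t (c e) else c e, fun w => by simp,
      fun u w hu hw => ?_⟩
    have : x ∉ s(u, w) := by
      rw [Sym2.mem_iff]; tauto
    simp [this]
  have hx'' : ∀ w, c' s(w, x) = Equiv.swap s t (c s(x, w)) := fun w => by
    rw [Sym2.eq_swap, hx']
  have hcol : ∀ u, u ≠ x → (colorsAt H c u).ncard < D → colorsAt H c' u ⊆ colorsAt H c u := by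
    rintro u hu hlt a ⟨w, huw, rfl⟩
    by_cases hw : w = x
    · subst hw
      rw [hx'', Equiv.swap_apply_of_ne_of_ne]
      · exact mem_colorsAt' huw.symm
      · intro e
        rw [fs u huw.symm e, full s hsX] at hlt
        exact lt_irrefl _ hlt
      · intro e
        rw [ft u huw.symm e, full t htX] at hlt
        exact lt_irrefl _ hlt
    · rw [hcc u w hu hw]
      exact mem_colorsAt huw
  have hcolx : ∀ a ∈ colorsAt H c' x, a ∈ X := by
    rintro a ⟨w, hxw, rfl⟩
    have k := hX _ (mem_colorsAt (c := c) hxw)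
    rw [hx', Equiv.swap_apply_def]
    split_ifs <;> assumption
  have hp' : ∀ u w w', H.Adj u w → H.Adj u w' → c' s(u, w) = c' s(u, w') → w = w' := by
    have key : ∀ u w, H.Adj u x → w ≠ x → H.Adj u w → c' s(u, x) ≠ c' s(u, w) := by
      intro u w hux hw huw e
      have hu := hux.ne
      rw [hx'', hcc u w hu hw] at e
      have k := mem_colorsAt (c := c) huw
      rw [← e] at k
      rw [Equiv.swap_apply_def] at k e
      split_ifs at k e with h₁ h₂
      · rw [fs u hux.symm h₁] at k
        simp [htX, hst.symm] at k
      · rw [ft u hux.symm h₂] at k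
        simp [hsX, hst] at k
      · exact hw (hp u x w hux huw (by rw [Sym2.eq_swap]; exact e)).symm
    intro u w w' h h' e
    by_cases hu : u = x
    · subst hu
      rw [hx', hx'] at e
      exact hp u w w' h h' ((Equiv.swap s t).injective e)
    by_cases hw : w = x
    · subst hw
      by_contra hne
      exact key u w' h (Ne.symm hne) h' e
    by_cases hw' : w' = x
    · subst hw'
      exact absurd e.symm (key u w h' hw h)
    rw [hcc u w hu hw, hcc u w' hu hw'] at e
    exact hp u w w' h h' e
  have hsame : ∀ a b, a ≠ s → a ≠ t → b ≠ s → b ≠ t →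
      bichromatic H c' a b = bichromatic H c a b := by
    intro a b has hat hbs hbt
    ext u w
    simp only [bichromatic_adj, and_congr_right_iff]
    intro h
    by_cases hu : u = x
    · subst hu
      rw [hx', Equiv.swap_apply_def]
      grind
    by_cases hw : w = x
    · subst hw
      rw [hx'', Sym2.eq_swap (a := u), Equiv.swap_apply_def]
      grind
    rw [hcc u w hu hw]
  have hboth : (bichromatic H c' s t).IsAcyclic := by
    suffices hle : bichromatic H c' s t ≤ bichromatic H c s t from (hac s t).anti hle
    intro u w h
    refine ⟨h.1, ?_⟩
    have h2 := h.2
    by_cases hu : u = x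
    · subst hu
      rw [hx', Equiv.swap_apply_def] at h2
      grind
    by_cases hw : w = x
    · subst hw
      rw [hx'', Equiv.swap_apply_def] at h2
      rw [Sym2.eq_swap]
      grind
    rwa [hcc u w hu hw] at h2
  have hone : ∀ r r' : α, (r = s ∧ r' = t ∨ r = t ∧ r' = s) → ∀ d, d ≠ s → d ≠ t →
      (bichromatic H c' r d).IsAcyclic := by
    intro r r' hrr d hds hdt
    have hrX : r ∈ X := by rcases hrr with ⟨rfl, rfl⟩ | ⟨rfl, rfl⟩ <;> assumption
    have hrd : r ≠ d := by rcases hrr with ⟨rfl, rfl⟩ | ⟨rfl, rfl⟩ <;> exact Ne.symm ‹_›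
    have hx_iff : ∀ w, (c' s(x, w) = r ↔ c s(x, w) = r') ∧ (c' s(x, w) = d ↔ c s(x, w) = d) := by
      intro w
      rw [hx', Equiv.swap_apply_def]
      grind
    have hfr : ∀ w, H.Adj x w → c s(x, w) = r' →
        colorsAt H c w = (insert r' Xᶜ : Finset α) := by
      rcases hrr with ⟨rfl, rfl⟩ | ⟨rfl, rfl⟩ <;> assumption
    have hle : ∀ u w, (bichromatic H c' r d).Adj u w → (u = x → c s(x, w) ≠ r') →
        (w = x → c s(x, u) ≠ r') → (bichromatic H c r d).Adj u w := by
      intro u w h hu hw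
      refine ⟨h.1, ?_⟩
      have h2 := h.2
      by_cases hux : u = x
      · subst hux
        rw [(hx_iff w).1, (hx_iff w).2] at h2
        exact Or.inr (h2.resolve_left (hu rfl))
      by_cases hwx : w = x
      · subst hwx
        rw [Sym2.eq_swap, (hx_iff u).1, (hx_iff u).2] at h2
        rw [Sym2.eq_swap]
        exact Or.inr (h2.resolve_left (hw rfl))
      rwa [hcc u w hux hwx] at h2
    by_cases hex : ∃ n, H.Adj x n ∧ c s(x, n) = r'
    swap
    · refine (hac r d).anti fun u w h => hle u w h ?_ ?_
      · rintro rfl e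
        exact hex ⟨w, h.1, e⟩
      · rintro rfl e
        exact hex ⟨u, h.1.symm, e⟩
    obtain ⟨n, hxn, hn⟩ := hex
    have hle' : ∀ u w, (bichromatic H c' r d).Adj u w → s(u, w) ≠ s(x, n) →
        (bichromatic H c r d).Adj u w := by
      intro u w h hne
      refine hle u w h ?_ ?_
      · rintro rfl e
        exact hne (by rw [hp u w n h.1 hxn (e.trans hn.symm)])
      · rintro rfl e
        exact hne (by rw [hp w u n h.1.symm hxn (e.trans hn.symm), Sym2.eq_swap])
    by_cases hdX : d ∈ X
    · refine isAcyclic_of_leaf (p := n) (q := x) (hac r d) (fun w h => ?_)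
        (fun u w h hne => hle' u w h (by rwa [Sym2.eq_swap (a := x)]))
      by_contra hwx
      have k := mem_colorsAt (c := c) h.1
      have h2 := h.2
      rw [hcc n w hxn.ne.symm hwx] at h2
      rw [hfr n hxn hn] at k
      rcases h2 with e | e <;> rw [e] at k <;> simp [hrX, hdX] at k <;> grind
    · refine isAcyclic_of_leaf (p := x) (q := n) (hac r d) (fun w h => ?_) hle'
      have h2 := h.2
      rw [(hx_iff w).1, (hx_iff w).2] at h2
      rcases h2 with e | e
      · exact hp x w n h.1 hxn (e.trans hn.symm)
      · exact absurd (hX _ (mem_colorsAt (c := c) h.1)) (by rwa [e])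
  have hst' : ∀ d, (bichromatic H c' s d).IsAcyclic ∧ (bichromatic H c' t d).IsAcyclic := by
    have hss : ∀ r r' : α, (bichromatic H c' r r').IsAcyclic → (bichromatic H c' r r).IsAcyclic :=
      fun r r' h => h.anti (show bichromatic H c' r r ≤ bichromatic H c' r r' from
        fun u w k => ⟨k.1, Or.inl (k.2.elim id id)⟩)
    intro d
    have hboth' := hboth
    rw [bichromatic_comm] at hboth'
    by_cases h₁ : d = s
    · subst h₁
      exact ⟨hss _ _ hboth, hboth'⟩
    by_cases h₂ : d = t
    · subst h₂
      exact ⟨hboth, hss _ _ hboth'⟩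
    exact ⟨hone s t (by simp) d h₁ h₂, hone t s (by simp) d h₁ h₂⟩
  refine ⟨c', isAcyclicEdgeColoring_iff.2 ⟨hp', fun a b => ?_⟩, hcolx, hcol, hsame, ?_⟩
  · by_cases has : a = s
    · subst has; exact (hst' b).1
    by_cases hat : a = t
    · subst hat; exact (hst' b).2
    by_cases hbs : b = s
    · subst hbs; rw [bichromatic_comm]; exact (hst' a).1
    by_cases hbt : b = t
    · subst hbt; rw [bichromatic_comm]; exact (hst' a).2
    rw [hsame a b has hat hbs hbt]
    exact hac a b
  · intro a haX u w hux hu hsu hr hwu hw hr'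
    obtain ⟨n, hxn, hn, q, hq⟩ := exists_first_edge hux.symm (fun h => haX (hX a h)) hr
    have hnu := reachable_of_eq_off hcc q hq
    have hns : s ∉ colorsAt H c' n := by
      rintro ⟨m, hnm, e⟩
      by_cases hm : m = x
      · subst hm
        rw [hx'', hn, Equiv.swap_apply_left] at e
        exact hst e.symm
      · rw [hcc n m hxn.ne.symm hm] at e
        exact hm (hp n m x hnm hxn.symm (by rw [e, Sym2.eq_swap, hn]))
    have hn_full : ¬ (colorsAt H c n).ncard < D := by
      rw [fs n hxn hn, full s hsX]
      exact lt_irrefl _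
    refine bichromatic_not_reachable hp' (Or.inr fun h => hsu (hcol u hux hu h)) (Or.inr hns) ?_
      (by rintro rfl; exact hn_full hu) hwu.symm ?_ hnu.symm hr'.symm
    · rcases hw with rfl | ⟨hlt, hw⟩
      · exact Or.inl fun h => haX (hcolx a h)
      · by_cases hwx : w = x
        · subst hwx
          exact Or.inl fun h => haX (hcolx a h)
        · exact hw.imp (fun k h => k (hcol w hwx hlt h)) (fun k h => k (hcol w hwx hlt h))
    · rcases hw with rfl | ⟨hlt, -⟩
      · exact hxn.ne.symm
      · rintro rfl
        exact hn_full hlt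

end Swap

section Configuration

/-- Some acyclic edge coloring of `H` extends to a new vertex joined to `x`, `y` and `z`. -/
def Extendable (α : Type*) (H : SimpleGraph V) (x y z : V) : Prop :=
  ∃ (c : Sym2 V → α) (a b d : α), IsAcyclicEdgeColoring H c ∧ a ≠ b ∧ a ≠ d ∧ b ≠ d ∧
    a ∉ colorsAt H c x ∧ b ∉ colorsAt H c y ∧ d ∉ colorsAt H c z ∧
    ¬ (bichromatic H c a b).Reachable x y ∧ ¬ (bichromatic H c a d).Reachable x z ∧
    ¬ (bichromatic H c b d).Reachable y z

variable {H : SimpleGraph V} {c : Sym2 V → α} {x y z : V} {X Y Z : Finset α}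

lemma Extendable.symm (h : Extendable α H x y z) : Extendable α H y x z := by
  obtain ⟨c, a, b, d, hc, hab, had, hbd, ha, hb, hd, rxy, rxz, ryz⟩ := h
  refine ⟨c, b, a, d, hc, hab.symm, hbd, had, hb, ha, hd, fun h => rxy ?_, ryz, rxz⟩
  rw [bichromatic_comm]
  exact h.symm

lemma ncard_le_of_subset [Fintype α] {S : Set α} {T : Finset α} (h : ∀ a ∈ S, a ∈ T) : S.ncard ≤ T.card := by
  rw [← Set.ncard_coe_finset]
  exact Set.ncard_le_ncard h

variable [Fintype α]

/-- An acyclic edge coloring `c` of `H` with sets `X`, `Y`, `Z` of colors containing the colors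
at `x`, `y`, `z`, where the first two have three elements and the third one misses three colors. -/
structure Configuration (H : SimpleGraph V) (c : Sym2 V → α) (x y z : V) (X Y Z : Finset α) :
    Prop where
  acyclic : IsAcyclicEdgeColoring H c
  subX : ∀ a ∈ colorsAt H c x, a ∈ X
  subY : ∀ a ∈ colorsAt H c y, a ∈ Y
  subZ : ∀ a ∈ colorsAt H c z, a ∈ Z
  cardX : X.card = 3
  cardY : Y.card = 3
  cardZ : Z.card + 3 = Fintype.card α
  six_le : 6 ≤ Fintype.card α
  deg : ∀ (c' : Sym2 V → α) (u : V), (colorsAt H c' u).ncard + 2 ≤ Fintype.card α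
  hxy : x ≠ y
  hxz : x ≠ z
  hyz : y ≠ z

namespace Configuration

lemma symm (h : Configuration H c x y z X Y Z) : Configuration H c y x z Y X Z :=
  ⟨h.acyclic, h.subY, h.subX, h.subZ, h.cardY, h.cardX, h.cardZ, h.six_le, h.deg, h.hxy.symm,
    h.hyz, h.hxz⟩

lemma extendable (h : Configuration H c x y z X Y Z) {a b d : α} (hab : a ≠ b) (had : a ≠ d)
    (hbd : b ≠ d) (ha : a ∉ X) (hb : b ∉ Y) (hd : d ∉ Z)
    (rxy : a ∈ Y → b ∈ X → ¬ (bichromatic H c a b).Reachable x y)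
    (rxz : a ∈ Z → d ∈ X → ¬ (bichromatic H c a d).Reachable x z)
    (ryz : b ∈ Z → d ∈ Y → ¬ (bichromatic H c b d).Reachable y z) : Extendable α H x y z := by
  have aux : ∀ {p q : V} {P Q : Finset α} {r s : α}, p ≠ q → (∀ a ∈ colorsAt H c p, a ∈ P) →
      (∀ a ∈ colorsAt H c q, a ∈ Q) → r ∉ P → s ∉ Q →
      (r ∈ Q → s ∈ P → ¬ (bichromatic H c r s).Reachable p q) →
      ¬ (bichromatic H c r s).Reachable p q := by
    intro p q P Q r s hpq hP hQ hr hs hrs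
    by_cases h₁ : r ∈ Q
    · by_cases h₂ : s ∈ P
      · exact hrs h₁ h₂
      · exact not_reachable_of_notMem hpq (fun k => hr (hP _ k)) (fun k => h₂ (hP _ k))
    · exact fun k => not_reachable_of_notMem hpq.symm (fun k => h₁ (hQ _ k))
        (fun k => hs (hQ _ k)) k.symm
  exact ⟨c, a, b, d, h.acyclic, hab, had, hbd, fun k => ha (h.subX _ k), fun k => hb (h.subY _ k),
    fun k => hd (h.subZ _ k), aux h.hxy h.subX h.subY ha hb rxy,
    aux h.hxz h.subX h.subZ ha hd rxz, aux h.hyz h.subY h.subZ hb hd ryz⟩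

lemma not_reachable_of_reachable (h : Configuration H c x y z X Y Z) {a s : α} (ha : a ∉ X)
    (hy : a ∉ Y ∨ s ∉ Y) (hz : s ∉ Z) (hr : (bichromatic H c a s).Reachable x y) :
    ¬ (bichromatic H c a s).Reachable x z :=
  bichromatic_not_reachable (isAcyclicEdgeColoring_iff.1 h.acyclic).1
    (Or.inl fun k => ha (h.subX _ k))
    (hy.imp (fun h' k => h' (h.subY _ k)) (fun h' k => h' (h.subY _ k)))
    (Or.inr fun k => hz (h.subZ _ k)) h.hxy h.hxz h.hyz hr

/-- If `s`, `t` are colors of `X` missing from `Y` and `Z` and the coloring does not extend,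
then the paths in the colors `a`, `s` and `a`, `t` starting at `x` end at `y` or `z`. -/
lemma reachable_or_reachable (h : Configuration H c x y z X Y Z) (hne : ¬ Extendable α H x y z)
    {s t : α} (hsX : s ∈ X) (htX : t ∈ X) (hst : s ≠ t) (hsY : s ∉ Y) (htY : t ∉ Y) (hsZ : s ∉ Z)
    (htZ : t ∉ Z) {a : α} (ha : a ∉ X) :
    (a ∈ Z ∧ (bichromatic H c a s).Reachable x z ∧ (bichromatic H c a t).Reachable x z) ∨
      (a ∈ Y ∧ (bichromatic H c a s).Reachable x y ∧ (bichromatic H c a t).Reachable x y) := by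
  have has : a ≠ s := by rintro rfl; exact ha hsX
  have hat : a ≠ t := by rintro rfl; exact ha htX
  have fin : ∀ s t, s ∈ X → t ∈ X → s ≠ t → s ∉ Y → t ∉ Y → s ∉ Z → t ∉ Z → a ≠ s → a ≠ t →
      (a ∈ Z ∧ (bichromatic H c a s).Reachable x z) ∨
        (a ∈ Y ∧ (bichromatic H c a t).Reachable x y) := by
    intro s t hsX htX hst hsY htY hsZ htZ has hat
    by_contra! k
    exact hne (h.extendable hat has hst.symm ha htY hsZ (fun k' _ => k.2 k') (fun k' _ => k.1 k')
      (fun k' => absurd k' htZ))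
  have f₁ := fin s t hsX htX hst hsY htY hsZ htZ has hat
  have f₂ := fin t s htX hsX hst.symm htY hsY htZ hsZ hat has
  have e₁ := h.not_reachable_of_reachable ha (Or.inr hsY) hsZ
  have e₂ := h.not_reachable_of_reachable ha (Or.inr htY) htZ
  tauto

variable [DecidableEq α]

lemma exists_swap (h : Configuration H c x y z X Y Z) {s t : α} (hsX : s ∈ X) (htX : t ∈ X)
    (hst : s ≠ t)
    (hs : ∀ a, a ∉ X → (s ∉ Y ∧ (bichromatic H c a s).Reachable x y) ∨
      (s ∉ Z ∧ (bichromatic H c a s).Reachable x z))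
    (ht : ∀ a, a ∉ X → (t ∉ Y ∧ (bichromatic H c a t).Reachable x y) ∨
      (t ∉ Z ∧ (bichromatic H c a t).Reachable x z)) :
    ∃ c', Configuration H c' x y z X Y Z ∧
      (∀ a b, a ≠ s → a ≠ t → b ≠ s → b ≠ t → bichromatic H c' a b = bichromatic H c a b) ∧
      (∀ a, a ∉ X → s ∉ Y → (bichromatic H c a s).Reachable x y →
        ¬ (bichromatic H c' a s).Reachable x y) ∧
      ∀ a, a ∉ X → s ∉ Z → (bichromatic H c a s).Reachable x z →
        ¬ (bichromatic H c' a s).Reachable x z ∧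
          (a ∉ Y → ¬ (bichromatic H c' a s).Reachable y z) := by
  have h6 := h.six_le
  have hy := ncard_le_of_subset h.subY
  have hz := ncard_le_of_subset h.subZ
  have hY := h.cardY
  have hZ := h.cardZ
  have hends : ∀ r : α, (∀ a, a ∉ X → (r ∉ Y ∧ (bichromatic H c a r).Reachable x y) ∨
      (r ∉ Z ∧ (bichromatic H c a r).Reachable x z)) →
      ∀ a, a ∉ X → ∃ u, u ≠ x ∧ r ∉ colorsAt H c u ∧ (bichromatic H c a r).Reachable x u := by
    intro r hr a ha
    rcases hr a ha with ⟨k, k'⟩ | ⟨k, k'⟩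
    · exact ⟨y, h.hxy.symm, fun k'' => k (h.subY _ k''), k'⟩
    · exact ⟨z, h.hxz.symm, fun k'' => k (h.subZ _ k''), k'⟩
  obtain ⟨c', hc', hcx, hcol, hsame, hnr⟩ := AcyclicEdgeColoring.exists_swap
    (D := Fintype.card α - 2) (by omega) (fun u => by have := h.deg c u; omega) h.cardX h.acyclic
    h.subX (hends s hs) (hends t ht) hsX htX hst
  refine ⟨c', ⟨hc', hcx, fun a ha => h.subY a (hcol y h.hxy.symm (by omega) ha),
    fun a ha => h.subZ a (hcol z h.hxz.symm (by omega) ha), h.cardX, h.cardY, h.cardZ, h6, h.deg,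
    h.hxy, h.hxz, h.hyz⟩, hsame, ?_, ?_⟩
  · intro a ha hsY hr
    exact hnr a ha y x h.hxy.symm (by omega) (fun k => hsY (h.subY _ k)) hr h.hxy (Or.inl rfl)
  · intro a ha hsZ hr
    have := hnr a ha z
    refine ⟨this x h.hxz.symm (by omega) (fun k => hsZ (h.subZ _ k)) hr h.hxz (Or.inl rfl),
      fun haY => this y h.hxz.symm (by omega) (fun k => hsZ (h.subZ _ k)) hr h.hyz
        (Or.inr ⟨by omega, Or.inl fun k => haY (h.subY _ k)⟩)⟩

/-- The case of a color missing from `X`, `Y` and `Z`. -/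
lemma extendable_of_common_missing (h : Configuration H c x y z X Y Z) {d : α} (hX : d ∉ X)
    (hY : d ∉ Y) (hZ : d ∉ Z) : Extendable α H x y z := by
  have h6 := h.six_le
  have h1 := h.cardX
  have h2 := h.cardY
  have h3 := h.cardZ
  by_cases hn : ∃ e, e ∉ X ∧ e ∉ Y ∧ e ≠ d
  · obtain ⟨e, heX, heY, hed⟩ := hn
    obtain ⟨b, hb⟩ : ∃ b, b ∉ insert e (insert d Y) := by
      by_contra! hall
      have := Finset.card_le_card (fun b _ => hall b : Finset.univ ⊆ insert e (insert d Y))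
      have := Finset.card_insert_le e (insert d Y)
      have := Finset.card_insert_le d Y
      rw [Finset.card_univ] at *
      omega
    simp only [Finset.mem_insert, not_or] at hb
    exact h.extendable (Ne.symm hb.1) hed hb.2.1 heX hb.2.2 hZ (fun k => absurd k heY)
      (fun _ k => absurd k hX) (fun _ k => absurd k hY)
  · push Not at hn
    have hcov : Finset.univ ⊆ insert d (X ∪ Y) := fun e _ => by
      rw [Finset.mem_insert, Finset.mem_union]
      by_contra! k
      exact k.1 (hn e k.2.1 k.2.2)
    have hcard := Finset.card_le_card hcov
    rw [Finset.card_univ] at hcard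
    have := Finset.card_insert_le d (X ∪ Y)
    have hui := Finset.card_union_add_card_inter X Y
    obtain ⟨s, hs⟩ : ∃ s, s ∉ insert d (Z ∪ (X ∩ Y)) := by
      by_contra! hall
      have := Finset.card_le_card (fun b _ => hall b : Finset.univ ⊆ insert d (Z ∪ (X ∩ Y)))
      have := Finset.card_insert_le d (Z ∪ (X ∩ Y))
      have := Finset.card_union_le Z (X ∩ Y)
      rw [Finset.card_univ] at *
      omega
    simp only [Finset.mem_insert, Finset.mem_union, Finset.mem_inter, not_or, not_and] at hs
    obtain ⟨hsd, hsZ, hsXY⟩ := hs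
    have pick : ∀ P Q : Finset α, P.card = 3 → (P ∩ Q).card ≤ 1 → ∃ b ∈ P, b ∉ Q ∧ b ≠ s := by
      intro P Q hP hPQ
      by_contra! hall
      have := Finset.card_le_card (show P ⊆ insert s (P ∩ Q) from fun b hb => by
        rw [Finset.mem_insert, Finset.mem_inter]
        by_cases hbQ : b ∈ Q
        · exact Or.inr ⟨hb, hbQ⟩
        · exact Or.inl (hall b hb hbQ))
      have := Finset.card_insert_le s (P ∩ Q)
      omega
    by_cases hsX : s ∈ X
    · obtain ⟨b, hbX, hbY, hbs⟩ := pick X Y h1 (by omega)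
      exact h.extendable (a := d) (b := b) (d := s) (by rintro rfl; exact hX hbX) (Ne.symm hsd)
        hbs hX hbY hsZ (fun k => absurd k hY) (fun k => absurd k hZ)
        (fun _ k => absurd k (hsXY hsX))
    · obtain ⟨b, hbY, hbX, hbs⟩ := pick Y X h2 (by rw [Finset.inter_comm]; omega)
      exact h.extendable (a := b) (b := d) (d := s) (by rintro rfl; exact hY hbY) hbs
        (Ne.symm hsd) hbX hY hsZ (fun _ k => absurd k hX) (fun _ k => absurd k hsX)
        (fun k => absurd k hZ)

/-- The case in which `X` is the complement of `Z` and paths in the colors `s`, `t` join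
`x` to `z`, if a further color `b` avoiding the other constraints is available. -/
lemma extendable_of_all_reachable (h : Configuration H c x y z X Y Z) (hXZ : ∀ a, a ∈ X ↔ a ∉ Z)
    {s t : α} (hsX : s ∈ X) (htX : t ∈ X) (hst : s ≠ t)
    (hs : ∀ a ∈ Z, (bichromatic H c a s).Reachable x z)
    (ht : ∀ a ∈ Z, (bichromatic H c a t).Reachable x z)
    {a b : α} (ha : a ∈ Z) (hb : b ∈ Z) (hab : a ≠ b) (hbY : b ∉ Y) : Extendable α H x y z := by
  have hZ : ∀ a, a ∉ X → a ∈ Z := fun a ha => by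
    by_contra hna
    exact ha ((hXZ a).2 hna)
  have hsZ := (hXZ s).1 hsX
  have htZ := (hXZ t).1 htX
  obtain ⟨c', h', -, -, hn⟩ := h.exists_swap hsX htX hst (fun a ha => Or.inr ⟨hsZ, hs a (hZ a ha)⟩)
    (fun a ha => Or.inr ⟨htZ, ht a (hZ a ha)⟩)
  have hX : ∀ a ∈ Z, a ∉ X := fun a ha k => (hXZ a).1 k ha
  exact h'.extendable (a := a) (b := b) (d := s) hab (by rintro rfl; exact hsZ ha)
    (by rintro rfl; exact hsZ hb) (hX a ha) hbY hsZ (fun _ k => absurd k (hX b hb))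
    (fun _ _ => (hn a (hX a ha) hsZ (hs a ha)).1)
    (fun _ _ => (hn b (hX b hb) hsZ (hs b hb)).2 hbY)

/-- The case in which `X` and `Y` are both the complement of `Z`. -/
lemma extendable_of_eq (h : Configuration H c x y z X Y Z) (hXZ : ∀ a, a ∈ X ↔ a ∉ Z)
    (hYZ : ∀ a, a ∈ Y ↔ a ∉ Z) : Extendable α H x y z := by
  by_contra hne
  have h6 := h.six_le
  have h1 := h.cardX
  have h3 := h.cardZ
  have hX : ∀ a ∈ Z, a ∉ X := fun a ha k => (hXZ a).1 k ha
  have hY : ∀ a ∈ Z, a ∉ Y := fun a ha k => (hYZ a).1 k ha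
  obtain ⟨a, b, ha, hb, hab⟩ := Finset.one_lt_card_iff.1 (show 1 < Z.card by omega)
  have fin : ∀ d ∈ X, ∀ a ∈ Z, ∀ b ∈ Z, a ≠ b → (bichromatic H c a d).Reachable x z ∨
      (bichromatic H c b d).Reachable y z := by
    intro d hd a ha b hb hab
    by_contra! k
    have hdZ := (hXZ d).1 hd
    exact hne (h.extendable hab (by rintro rfl; exact hdZ ha) (by rintro rfl; exact hdZ hb)
      (hX a ha) (hY b hb) hdZ (fun k => absurd k (hY a ha)) (fun _ _ => k.1) (fun _ _ => k.2))
  have key : ∀ d ∈ X, (∀ a ∈ Z, (bichromatic H c a d).Reachable x z) ∨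
      ∀ a ∈ Z, (bichromatic H c a d).Reachable y z := by
    intro d hd
    by_contra! k
    obtain ⟨⟨a₁, ha₁, k₁⟩, a₂, ha₂, k₂⟩ := k
    by_cases he : a₁ = a₂
    · subst he
      obtain ⟨e, he, hea⟩ := Finset.exists_mem_ne (show 1 < Z.card by omega) a₁
      have r₁ := (fin d hd a₁ ha₁ e he hea.symm).resolve_left k₁
      have r₂ := (fin d hd e he a₁ ha₁ hea).resolve_right k₂
      exact bichromatic_not_reachable (isAcyclicEdgeColoring_iff.1 h.acyclic).1
        (Or.inr fun k => (hXZ d).1 hd (h.subZ _ k)) (Or.inl fun k => hX e he (h.subX _ k))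
        (Or.inl fun k => hY e he (h.subY _ k)) h.hxz.symm h.hyz.symm h.hxy r₂.symm r₁.symm
    · exact (fin d hd a₁ ha₁ a₂ ha₂ he).elim k₁ k₂
  have hxx : ∀ s ∈ X, ∀ t ∈ X, s ≠ t → (∀ a ∈ Z, (bichromatic H c a s).Reachable x z) →
      ¬ ∀ a ∈ Z, (bichromatic H c a t).Reachable x z := fun s hs t ht hst k k' =>
    hne (h.extendable_of_all_reachable hXZ hs ht hst k k' ha hb hab (hY b hb))
  have hyy : ∀ s ∈ X, ∀ t ∈ X, s ≠ t → (∀ a ∈ Z, (bichromatic H c a s).Reachable y z) →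
      ¬ ∀ a ∈ Z, (bichromatic H c a t).Reachable y z := fun s hs t ht hst k k' =>
    hne (h.symm.extendable_of_all_reachable hYZ ((hYZ s).2 ((hXZ s).1 hs))
      ((hYZ t).2 ((hXZ t).1 ht)) hst k k' ha hb hab (hX b hb)).symm
  obtain ⟨r, s, t, hrs, hrt, hst, rfl⟩ := Finset.card_eq_three.1 h1
  have hr' : r ∈ ({r, s, t} : Finset α) := by simp
  have hs' : s ∈ ({r, s, t} : Finset α) := by simp
  have ht' : t ∈ ({r, s, t} : Finset α) := by simp
  rcases key r hr' with k₁ | k₁ <;> rcases key s hs' with k₂ | k₂ <;>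
    rcases key t ht' with k₃ | k₃ <;>
    first
    | exact hxx r hr' s hs' hrs k₁ k₂
    | exact hxx r hr' t ht' hrt k₁ k₃
    | exact hxx s hs' t ht' hst k₂ k₃
    | exact hyy r hr' s hs' hrs k₁ k₂
    | exact hyy r hr' t ht' hrt k₁ k₃
    | exact hyy s hs' t ht' hst k₂ k₃

/-- The case in which `X` is the complement of `Z` and two of its colors are missing from `Y`. -/
lemma extendable_of_two_missing (h : Configuration H c x y z X Y Z) (hXZ : ∀ a, a ∈ X ↔ a ∉ Z)
    {s t : α} (hsX : s ∈ X) (htX : t ∈ X) (hst : s ≠ t) (hsY : s ∉ Y) (htY : t ∉ Y) :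
    Extendable α H x y z := by
  by_contra hne
  have h6 := h.six_le
  have h1 := h.cardX
  have h2 := h.cardY
  have h3 := h.cardZ
  have hsZ := (hXZ s).1 hsX
  have htZ := (hXZ t).1 htX
  have hX : ∀ a ∈ Z, a ∉ X := fun a ha k => (hXZ a).1 k ha
  have key := fun a (ha : a ∉ X) =>
    h.reachable_or_reachable hne hsX htX hst hsY htY hsZ htZ ha
  obtain ⟨c', h', hsame, hn₁, hn₂⟩ := h.exists_swap hsX htX hst
    (fun a ha => by have := key a ha; tauto) (fun a ha => by have := key a ha; tauto)
  by_cases hZY : Z ⊆ Y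
  · have hYZ : Z = Y := Finset.eq_of_subset_of_card_le hZY (by omega)
    obtain ⟨r, hr⟩ : ∃ r ∈ X, r ∉ ({s, t} : Finset α) := by
      refine Finset.exists_mem_notMem_of_card_lt_card ?_
      have := Finset.card_le_two (a := s) (b := t)
      omega
    simp only [Finset.mem_insert, Finset.mem_singleton, not_or] at hr
    obtain ⟨hrX, hrs, hrt⟩ := hr
    have hrZ := (hXZ r).1 hrX
    have hrY : r ∉ Y := hYZ ▸ hrZ
    obtain ⟨a, ha⟩ := Finset.card_pos.1 (show 0 < Z.card by omega)
    have haX := hX a ha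
    have has : a ≠ s := by rintro rfl; exact hsZ ha
    have hat : a ≠ t := by rintro rfl; exact htZ ha
    have har : a ≠ r := by rintro rfl; exact hrZ ha
    have hsr := h.reachable_or_reachable hne hsX hrX (Ne.symm hrs) hsY hrY hsZ hrZ haX
    have ear := hsame a r has hat hrs hrt
    have excl := h'.not_reachable_of_reachable haX (Or.inr hrY) hrZ
    rcases hsr with ⟨-, k₁, k₂⟩ | ⟨-, k₁, k₂⟩
    · rw [← ear] at k₂
      exact hne (h'.extendable har has hrs haX hrY hsZ (fun _ _ k => excl k k₂)
        (fun _ _ => (hn₂ a haX hsZ k₁).1) (fun k => absurd k hrZ))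
    · rw [← ear] at k₂
      exact hne (h'.extendable has har (Ne.symm hrs) haX hsY hrZ (fun _ _ => hn₁ a haX hsY k₁)
        (fun _ _ => excl k₂) (fun k => absurd k hsZ))
  · obtain ⟨a, ha, haY⟩ := Finset.not_subset.1 hZY
    have haX := hX a ha
    have k := (key a haX).resolve_right fun k => haY k.1
    exact hne (h'.extendable (a := a) (b := t) (d := s) (by rintro rfl; exact htZ ha)
      (by rintro rfl; exact hsZ ha) hst.symm haX htY hsZ (fun k => absurd k haY)
      (fun _ _ => (hn₂ a haX hsZ k.2.1).1) (fun k => absurd k htZ))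

/-- The case in which `X` is the complement of `Z` and just one of its colors is missing
from `Y`. -/
lemma extendable_of_one_missing (h : Configuration H c x y z X Y Z) (hXZ : ∀ a, a ∈ X ↔ a ∉ Z)
    {s : α} (hsX : s ∈ X) (hsY : s ∉ Y) (hY : ∀ t ∈ X, t ≠ s → t ∈ Y) : Extendable α H x y z := by
  by_contra hne
  have h6 := h.six_le
  have h1 := h.cardX
  have h2 := h.cardY
  have h3 := h.cardZ
  have hsZ := (hXZ s).1 hsX
  have hX : ∀ a ∈ Z, a ∉ X := fun a ha k => (hXZ a).1 k ha
  obtain ⟨t, htX, hts⟩ := Finset.exists_mem_ne (show 1 < X.card by omega) s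
  have htZ := (hXZ t).1 htX
  have hcard : 1 < (Z \ Y).card := by
    have hsub : X.erase s ⊆ Y \ Z := fun t ht => by
      rw [Finset.mem_erase] at ht
      exact Finset.mem_sdiff.2 ⟨hY t ht.2 ht.1, (hXZ t).1 ht.2⟩
    have k₁ := Finset.card_le_card hsub
    rw [Finset.card_erase_of_mem hsX] at k₁
    have k₂ := Finset.card_sdiff_add_card_inter Y Z
    have k₃ := Finset.card_sdiff_add_card_inter Z Y
    rw [Finset.inter_comm] at k₃
    omega
  have hs : ∀ a ∈ Z, (bichromatic H c a s).Reachable x z := by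
    intro a ha
    by_contra k
    obtain ⟨b, hb, hba⟩ := Finset.exists_mem_ne hcard a
    rw [Finset.mem_sdiff] at hb
    exact hne (h.extendable (a := a) (b := b) (d := s) hba.symm (by rintro rfl; exact hsZ ha)
      (by rintro rfl; exact hsZ hb.1) (hX a ha) hb.2 hsZ (fun _ k => absurd k (hX b hb.1))
      (fun _ _ => k) (fun _ k => absurd k hsY))
  have ht : ∀ a ∈ Z, (bichromatic H c a t).Reachable x z := by
    intro a ha
    by_contra k
    exact hne (h.extendable (a := a) (b := s) (d := t) (by rintro rfl; exact hsZ ha)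
      (by rintro rfl; exact htZ ha) hts.symm (hX a ha) hsY htZ
      (fun _ _ k => h.not_reachable_of_reachable (hX a ha) (Or.inr hsY) hsZ k (hs a ha))
      (fun _ _ => k) (fun k => absurd k hsZ))
  obtain ⟨a, b, ha, hb, hab⟩ := Finset.one_lt_card_iff.1 hcard
  rw [Finset.mem_sdiff] at ha hb
  exact hne (h.extendable_of_all_reachable hXZ hsX htX hts.symm hs ht ha.1 hb.1 hab hb.2)

lemma extendable_of_compl (h : Configuration H c x y z X Y Z) (hXZ : ∀ a, a ∈ X ↔ a ∉ Z) :
    Extendable α H x y z := by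
  by_cases hXY : X ⊆ Y
  · have := Finset.eq_of_subset_of_card_le hXY (by rw [h.cardX, h.cardY])
    subst this
    exact h.extendable_of_eq hXZ hXZ
  · obtain ⟨s, hsX, hsY⟩ := Finset.not_subset.1 hXY
    by_cases hall : ∀ t ∈ X, t ≠ s → t ∈ Y
    · exact h.extendable_of_one_missing hXZ hsX hsY hall
    · push Not at hall
      obtain ⟨t, htX, hts, htY⟩ := hall
      exact h.extendable_of_two_missing hXZ hsX htX hts.symm hsY htY

/-- The case in which `X` and `Y` are complementary. -/
lemma extendable_of_compl_left (h : Configuration H c x y z X Y Z) (hXY : ∀ a, a ∈ X ↔ a ∉ Y)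
    {s t a : α} (hsX : s ∈ X) (htX : t ∈ X) (hst : s ≠ t) (hsZ : s ∉ Z) (htZ : t ∉ Z)
    (haY : a ∈ Y) (haZ : a ∉ Z) : Extendable α H x y z := by
  by_contra hne
  have hsY := (hXY s).1 hsX
  have htY := (hXY t).1 htX
  have key := fun a (ha : a ∉ X) =>
    h.reachable_or_reachable hne hsX htX hst hsY htY hsZ htZ ha
  have haX : a ∉ X := fun k => (hXY a).1 k haY
  obtain ⟨c', h', -, hn, -⟩ := h.exists_swap hsX htX hst
    (fun a ha => by have := key a ha; tauto) (fun a ha => by have := key a ha; tauto)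
  have k := (key a haX).resolve_left fun k => haZ k.1
  exact hne (h'.extendable (a := a) (b := s) (d := t) (by rintro rfl; exact haX hsX)
    (by rintro rfl; exact haX htX) hst haX hsY htZ (fun _ _ => hn a haX hsY k.2.1)
    (fun k => absurd k haZ) (fun k => absurd k hsZ))

theorem extendable_of_configuration (h : Configuration H c x y z X Y Z) :
    Extendable α H x y z := by
  have h6 := h.six_le
  have h1 := h.cardX
  have h2 := h.cardY
  have h3 := h.cardZ
  by_cases hcov : ∃ d, d ∉ X ∧ d ∉ Y ∧ d ∉ Z
  · obtain ⟨d, hX, hY, hZ⟩ := hcov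
    exact h.extendable_of_common_missing hX hY hZ
  push Not at hcov
  have hZc : (Zᶜ).card = 3 := by rw [Finset.card_compl]; omega
  have compl : ∀ P : Finset α, P.card = 3 → (∀ a, a ∉ Z → a ∈ P) → ∀ a, a ∈ P ↔ a ∉ Z := by
    intro P hP hsub a
    have : Zᶜ = P := Finset.eq_of_subset_of_card_le
      (fun a ha => hsub a (Finset.mem_compl.1 ha)) (by omega)
    rw [← this, Finset.mem_compl]
  by_cases hXZ : ∀ a, a ∉ Z → a ∈ X
  · exact h.extendable_of_compl (compl X h1 hXZ)
  by_cases hYZ : ∀ a, a ∉ Z → a ∈ Y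
  · exact (h.symm.extendable_of_compl (compl Y h2 hYZ)).symm
  push Not at hXZ hYZ
  obtain ⟨a, haZ, haX⟩ := hXZ
  obtain ⟨d, hdZ, hdY⟩ := hYZ
  have haY : a ∈ Y := by
    by_contra k
    exact haZ (hcov a haX k)
  have hdX : d ∈ X := by
    by_contra k
    exact hdZ (hcov d k hdY)
  by_cases hb : ∃ b, b ∉ X ∧ b ∉ Y
  · obtain ⟨b, hbX, hbY⟩ := hb
    exact h.extendable (a := a) (b := b) (d := d) (by rintro rfl; exact hbY haY)
      (by rintro rfl; exact haX hdX) (by rintro rfl; exact hbX hdX) haX hbY hdZ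
      (fun _ k => absurd k hbX) (fun k => absurd k haZ) (fun _ k => absurd k hdY)
  push Not at hb
  have hXY : ∀ a, a ∈ X ↔ a ∉ Y := by
    have : Yᶜ = X := by
      refine Finset.eq_of_subset_of_card_le (fun a ha => ?_) (by rw [Finset.card_compl]; omega)
      by_contra k
      exact Finset.mem_compl.1 ha (hb a k)
    intro a
    rw [← this, Finset.mem_compl]
  obtain ⟨e, heZ, hea, hed⟩ : ∃ e, e ∉ Z ∧ e ≠ a ∧ e ≠ d := by
    obtain ⟨e, he, k⟩ := Finset.exists_mem_notMem_of_card_lt_card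
      (show ({a, d} : Finset α).card < (Zᶜ).card by
        have := Finset.card_le_two (a := a) (b := d)
        omega)
    simp only [Finset.mem_insert, Finset.mem_singleton, not_or] at k
    exact ⟨e, Finset.mem_compl.1 he, k.1, k.2⟩
  by_cases heX : e ∈ X
  · exact h.extendable_of_compl_left hXY heX hdX hed heZ hdZ haY haZ
  · exact (h.symm.extendable_of_compl_left (fun a => by rw [hXY, not_not]) (hb e heX) haY hea
      heZ haZ hdX hdZ).symm

end Configuration

end Configuration

lemma ncard_colorsAt_le [Fintype V] (G : SimpleGraph V) [DecidableRel G.Adj] (c : Sym2 V → α)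
    (u v : V) : (colorsAt (G.deleteIncidenceSet v) c u).ncard ≤ G.degree u ∧
      (G.Adj u v → (colorsAt (G.deleteIncidenceSet v) c u).ncard + 1 ≤ G.degree u) := by
  classical
  have key : colorsAt (G.deleteIncidenceSet v) c u ⊆
      (((G.neighborFinset u).erase v).image fun w => c s(u, w) : Finset α) := by
    rintro a ⟨w, hw, rfl⟩
    rw [deleteIncidenceSet_adj] at hw
    simp only [Finset.coe_image, Set.mem_image, Finset.mem_coe, Finset.mem_erase,
      mem_neighborFinset]
    exact ⟨w, ⟨hw.2.2, hw.1⟩, rfl⟩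
  have hle := Set.ncard_le_ncard key
  rw [Set.ncard_coe_finset] at hle
  have hle' := hle.trans Finset.card_image_le
  constructor
  · exact hle'.trans (Finset.card_le_card (Finset.erase_subset _ _))
  · intro h
    rw [Finset.card_erase_of_mem (by simpa using h), card_neighborFinset_eq_degree] at hle'
    have : 0 < G.degree u := (G.degree_pos_iff_exists_adj u).2 ⟨v, h⟩
    omega

lemma exists_finset_superset [Fintype α] (S : Set α) {n : ℕ} (h : S.ncard ≤ n)
    (hn : n ≤ Fintype.card α) : ∃ T : Finset α, (∀ a ∈ S, a ∈ T) ∧ T.card = n := by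
  classical
  rw [Set.ncard_eq_toFinset_card'] at h
  obtain ⟨T, hT, hcard⟩ := Finset.exists_superset_card_eq h hn
  exact ⟨T, fun a ha => hT (by simpa using ha), hcard⟩

lemma five_le_degree [Fintype V] (G : SimpleGraph V) [DecidableRel G.Adj]
    (hG : IsAcyclicallyEdgeCritical G (G.maxDegree + 2))
    (v x y z : V) (hv : G.degree v = 3)
    (hx : G.Adj v x) (hy : G.Adj v y) (hz : G.Adj v z)
    (hxy : x ≠ y) (hxz : x ≠ z) (hyz : y ≠ z)
    (hdx : G.degree x = 4) : 5 ≤ G.degree y := by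
  classical
  by_contra hdy
  have hN : ∀ w, G.Adj v w → w = x ∨ w = y ∨ w = z := by
    have h₁ : ({x, y, z} : Finset V) = G.neighborFinset v := by
      refine Finset.eq_of_subset_of_card_le (fun w hw => ?_) ?_
      · simp only [Finset.mem_insert, Finset.mem_singleton] at hw
        rw [mem_neighborFinset]
        rcases hw with rfl | rfl | rfl <;> assumption
      · rw [card_neighborFinset_eq_degree, hv, Finset.card_eq_three.2 ⟨x, y, z, hxy, hxz, hyz, rfl⟩]
    intro w hw
    rw [← mem_neighborFinset, ← h₁] at hw
    simpa using hw
  have hlt : G.deleteIncidenceSet v < G := by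
    refine lt_of_le_of_ne (G.deleteIncidenceSet_le v) fun e => ?_
    rw [← e, deleteIncidenceSet_adj] at hx
    exact hx.2.1 rfl
  obtain ⟨c, hc⟩ := hG.2 _ hlt
  have hΔ := fun u => G.degree_le_maxDegree u
  have hΔx := hΔ x
  have hΔz := hΔ z
  have hcard : Fintype.card (Fin (G.maxDegree + 2)) = G.maxDegree + 2 := Fintype.card_fin _
  have bound := fun c u => ncard_colorsAt_le (α := Fin (G.maxDegree + 2)) G c u v
  obtain ⟨X, hX, hX3⟩ := exists_finset_superset
    (colorsAt (G.deleteIncidenceSet v) c x) (n := 3)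
    (by have := (bound c x).2 hx.symm; omega) (by omega)
  obtain ⟨Y, hY, hY3⟩ := exists_finset_superset
    (colorsAt (G.deleteIncidenceSet v) c y) (n := 3)
    (by have := (bound c y).2 hy.symm; omega) (by omega)
  obtain ⟨Z, hZ, hZ3⟩ := exists_finset_superset
    (colorsAt (G.deleteIncidenceSet v) c z) (n := G.maxDegree - 1)
    (by have := (bound c z).2 hz.symm; omega) (by omega)
  have conf : Configuration (G.deleteIncidenceSet v) c x y z X Y Z :=
    { acyclic := hc, subX := hX, subY := hY, subZ := hZ, cardX := hX3, cardY := hY3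
      cardZ := by omega
      six_le := by omega
      deg := fun c' u => by have := (bound c' u).1; have := hΔ u; omega
      hxy := hxy, hxz := hxz, hyz := hyz }
  obtain ⟨c', a, b, d, hc', hab, had, hbd, ha, hb, hd, rxy, rxz, ryz⟩ :=
    conf.extendable_of_configuration
  exact hG.1 (exists_isAcyclicEdgeColoring_of_extends hN hx.ne hy.ne hz.ne hxy hxz hyz hc' hab had
    hbd ha hb hd rxy rxz ryz)

end AcyclicEdgeColoring

theorem stmt11 {V : Type*} [Fintype V] (G : SimpleGraph V) [DecidableRel G.Adj]
    (hG : IsAcyclicallyEdgeCritical G (G.maxDegree + 2))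
    (v x y z : V) (hv : G.degree v = 3)
    (hx : G.Adj v x) (hy : G.Adj v y) (hz : G.Adj v z)
    (hxy : x ≠ y) (hxz : x ≠ z) (hyz : y ≠ z)
    (hdx : G.degree x = 4) :
    5 ≤ G.degree y ∧ 5 ≤ G.degree z := by
  exact ⟨AcyclicEdgeColoring.five_le_degree G hG v x y z hv hx hy hz hxy hxz hyz hdx,
    AcyclicEdgeColoring.five_le_degree G hG v x z y hv hx hz hy hxz hxy hyz.symm hdx⟩
end
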